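/- arXiv:2012.03523 — 3 statements merged into one kernel-verified Lean document; each statement's English description precedes it below -/
import Mathlib

section
/- (Regular singular point at u = 0.) Let m ≥ 1 and let ℓ_{m,j} ∈ ℚ[X] (0 ≤ j ≤ m) be the coefficient polynomials of the Vanhove operator L̃_m. Then for every j ∈ {0,…,m} with e := j + ⌊(m+1)/2⌋ − m > 0, the monomial X^e divides ℓ_{m,j} in ℚ[X]; equivalently, u^{m−j−⌊(m+1)/2⌋}·ℓ_{m,j}(u) is a polynomial in u for all 0 ≤ j ≤ m. -/
open scoped BigOperators
open Matrix Polynomial Filter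

/-- The operator `(ϑ g)(u) = d/du (u · g(u))`. -/
noncomputable def theta (g : ℝ → ℝ) : ℝ → ℝ := deriv fun u => u * g u

/-- The operator `ϑ - c`. -/
noncomputable def thetaShift (c : ℝ) (g : ℝ → ℝ) : ℝ → ℝ := fun u => theta g u - c * g u

/-- Value `α_n` of an index tuple `(α_1, …, α_r)`, with the convention `α_{r+1} = 1`. -/
def tupVal {r m : ℕ} (a : Fin r → Fin (m + 2)) (n : ℕ) : ℕ :=
  if h : 1 ≤ n ∧ n ≤ r then (a ⟨n - 1, by omega⟩).val else 1

/-- `vanhoveChain m r α (r+1)` is the operator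
`(ϑ−r)^{m+1−α₁} (ϑ−r+1)^{α₁−α₂} ⋯ (ϑ−r+r)^{α_r−α_{r+1}}`
(applying the rightmost factor first). -/
noncomputable def vanhoveChain (m r : ℕ) (α : ℕ → ℕ) : ℕ → (ℝ → ℝ) → (ℝ → ℝ)
  | 0, f => f
  | j + 1, f =>
      (thetaShift (j : ℝ))^[if j = r then m + 1 - α 1 else α (r - j) - α (r - j + 1)]
        (vanhoveChain m r α j f)

open Classical in
/-- The Vanhove operator `L̃_m` in explicit (Verrill-type) form. -/
noncomputable def vanhove (m : ℕ) (f : ℝ → ℝ) : ℝ → ℝ := fun u =>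
  u * (theta^[m] f) u +
    ∑ r ∈ Finset.Icc 1 (m / 2 + 1),
      u ^ (1 - (r : ℤ)) *
        ∑ a ∈ Finset.univ.filter (fun a : Fin r → Fin (m + 2) =>
            ∀ n ∈ Finset.Icc 1 r,
              1 ≤ tupVal a n ∧ (tupVal a (n + 1) : ℤ) ≤ (tupVal a n : ℤ) - 2),
          (∏ n ∈ Finset.Icc 1 r, ((tupVal a n : ℝ) * ((tupVal a n : ℝ) - m - 2))) *
            vanhoveChain m r (tupVal a) (r + 1) f u


lemma theta_monomial (s : ℕ) (a : ℝ) :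
    theta (fun u => a * u ^ s) = fun u => (a * (s + 1)) * u ^ s := by
  funext u
  have h : (fun u : ℝ => u * (a * u ^ s)) = fun u => a * u ^ (s + 1) := by
    funext v; ring
  unfold theta
  rw [h]
  simp
  ring

lemma thetaShift_monomial (s : ℕ) (c a : ℝ) :
    thetaShift c (fun u => a * u ^ s) = fun u => (a * (s + 1 - c)) * u ^ s := by
  funext u
  simp only [thetaShift, theta_monomial]
  ring

lemma theta_iter_monomial (s n : ℕ) (a : ℝ) :
    ∃ b : ℝ, theta^[n] (fun u => a * u ^ s) = fun u => b * u ^ s := by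
  induction n generalizing a with
  | zero => exact ⟨a, rfl⟩
  | succ n ih =>
    rw [Function.iterate_succ_apply, theta_monomial]
    exact ih _

lemma thetaShift_iter_monomial (s n : ℕ) (c a : ℝ) :
    ∃ b : ℝ, (thetaShift c)^[n] (fun u => a * u ^ s) = fun u => b * u ^ s := by
  induction n generalizing a with
  | zero => exact ⟨a, rfl⟩
  | succ n ih =>
    rw [Function.iterate_succ_apply, thetaShift_monomial]
    exact ih _

lemma vanhoveChain_monomial (m r : ℕ) (α : ℕ → ℕ) (s k : ℕ) :
    ∃ b : ℝ, vanhoveChain m r α k (fun u => 1 * u ^ s) = fun u => b * u ^ s := by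
  induction k with
  | zero => exact ⟨1, rfl⟩
  | succ k ih =>
    obtain ⟨b, hb⟩ := ih
    rw [vanhoveChain, hb]
    exact thetaShift_iter_monomial _ _ _ _

lemma vanhove_monomial (m s : ℕ) :
    ∃ q : ℝ[X], ∀ u : ℝ, u ≠ 0 →
      u ^ (m / 2) * vanhove m (fun u => 1 * u ^ s) u = u ^ s * q.eval u := by
  classical
  obtain ⟨b, hb⟩ := theta_iter_monomial s m 1
  choose c hc using fun (r : ℕ) (α : ℕ → ℕ) => vanhoveChain_monomial m r α s (r + 1)
  refine ⟨C b * X ^ (m / 2 + 1) + ∑ r ∈ Finset.Icc 1 (m / 2 + 1),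
      X ^ (m / 2 + 1 - r) * C (
        ∑ a ∈ Finset.univ.filter (fun a : Fin r → Fin (m + 2) =>
            ∀ n ∈ Finset.Icc 1 r,
              1 ≤ tupVal a n ∧ (tupVal a (n + 1) : ℤ) ≤ (tupVal a n : ℤ) - 2),
          (∏ n ∈ Finset.Icc 1 r, ((tupVal a n : ℝ) * ((tupVal a n : ℝ) - m - 2))) *
            c r (tupVal a)), fun u hu => ?_⟩
  simp only [vanhove, hb, hc, eval_add, eval_mul, eval_finsetSum, eval_pow, eval_X, eval_C]
  rw [mul_add, mul_add, Finset.mul_sum, Finset.mul_sum]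
  congr 1
  · ring
  · refine Finset.sum_congr rfl fun r hr => ?_
    rw [Finset.mem_Icc] at hr
    have h1 : u ^ (m / 2) * u ^ (1 - (r : ℤ)) = u ^ (m / 2 + 1 - r) := by
      rw [← zpow_natCast, ← zpow_natCast, ← zpow_add₀ hu]
      congr 1
      omega
    rw [← mul_assoc, h1, mul_left_comm]
    congr 1
    rw [Finset.mul_sum]
    rw [Finset.sum_congr (s₂ := Finset.univ.filter (fun a : Fin r → Fin (m + 2) =>
            ∀ n ∈ Finset.Icc 1 r,
              1 ≤ tupVal a n ∧ (tupVal a (n + 1) : ℤ) ≤ (tupVal a n : ℤ) - 2)) (by congr)]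
    intro a _
    ring

/-- regular singular point at `u = 0`: divisibility of the Vanhove
coefficient polynomials by powers of `X`. -/
theorem vanhove_coeff_divisibility (m : ℕ) (hm : 1 ≤ m) (L : ℕ → Polynomial ℚ)
    (hL : ∀ f : ℝ → ℝ, ContDiff ℝ (⊤ : ℕ∞) f → ∀ u : ℝ, u ≠ 0 →
      vanhove (m) f u =
        ∑ j ∈ Finset.range (m + 1), Polynomial.aeval u (L j) * iteratedDeriv j f u) :
    ∀ j ≤ m, (Polynomial.X : Polynomial ℚ) ^ (j + (m + 1) / 2 - m) ∣ L j := by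
  have key : ∀ j ≤ m, (X : ℝ[X]) ^ j ∣ X ^ (m / 2) * (L j).map (algebraMap ℚ ℝ) := by
    intro s
    induction s using Nat.strong_induction_on with
    | _ s ih =>
    intro hs
    obtain ⟨q, hq⟩ := vanhove_monomial m s
    have hpoly : X ^ s * q = ∑ j ∈ Finset.range (s + 1),
        X ^ (m / 2) * (L j).map (algebraMap ℚ ℝ) *
          (C (s.descFactorial j : ℝ) * X ^ (s - j)) := by
      refine Polynomial.eq_of_infinite_eval_eq _ _
        (Set.Infinite.mono (s := {0}ᶜ) ?_ (Set.finite_singleton (0 : ℝ)).infinite_compl)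
      intro u hu
      have hu : u ≠ 0 := hu
      simp only [Set.mem_ofPred_eq]
      rw [eval_mul, eval_pow, eval_X, ← hq u hu, hL (fun u => 1 * u ^ s) (by fun_prop) u hu, eval_finsetSum,
        Finset.mul_sum]
      have hsub : Finset.range (s + 1) ⊆ Finset.range (m + 1) := by
        intro x; simp only [Finset.mem_range]; omega
      rw [← Finset.sum_subset hsub]
      · refine Finset.sum_congr rfl fun j _ => ?_
        simp only [one_mul, iteratedDeriv_pow]
        simp [eval_map_algebraMap]
        ring
      · intro j _ hj
        rw [Finset.mem_range, not_lt] at hj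
        have : s.descFactorial j = 0 := Nat.descFactorial_of_lt (by omega)
        simp only [one_mul, iteratedDeriv_pow]
        simp [this]
    rw [Finset.sum_range_succ] at hpoly
    have h1 : (X : ℝ[X]) ^ s ∣ ∑ j ∈ Finset.range s,
        X ^ (m / 2) * (L j).map (algebraMap ℚ ℝ) *
          (C (s.descFactorial j : ℝ) * X ^ (s - j)) := by
      refine Finset.dvd_sum fun j hj => ?_
      rw [Finset.mem_range] at hj
      have := ih j hj (by omega)
      have h2 : (X : ℝ[X]) ^ s = X ^ j * X ^ (s - j) := by
        rw [← pow_add]; congr 1; omega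
      rw [h2]
      exact mul_dvd_mul this (Dvd.intro_left _ rfl)
    have h2 := (Nat.cast_ne_zero (R := ℝ)).2 (Nat.factorial_ne_zero s)
    have h3 : (X : ℝ[X]) ^ s ∣ X ^ (m / 2) * (L s).map (algebraMap ℚ ℝ) *
          (C (s.descFactorial s : ℝ) * X ^ (s - s)) :=
      (dvd_add_right h1).1 (hpoly ▸ Dvd.intro _ rfl)
    rw [Nat.sub_self, pow_zero, mul_one, Nat.descFactorial_self] at h3
    have hu : IsUnit (C (s.factorial : ℝ)) := Polynomial.isUnit_C.2 h2.isUnit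
    exact (hu.dvd_mul_right).1 h3
  intro j hj
  rw [Polynomial.X_pow_dvd_iff]
  intro d hd
  have h := (Polynomial.X_pow_dvd_iff.1 (key j hj)) (d + m / 2) (by omega)
  rw [coeff_X_pow_mul, coeff_map] at h
  exact (map_eq_zero _).1 h
end

section
/- (Iterations of the Bessel differential operator.) Let B be the operator sending a smooth function g : ℝ → ℝ to (Bg)(u) = u·g″(u) + g′(u). Then for every n ≥ 0, every smooth f : ℝ → ℝ, and every u ∈ ℝ: (Bⁿf)(u) = Σ_{m=0}^{n} (n!/m!)·C(n,m)·u^m·f^{(n+m)}(u), and (d/du)(Bⁿf)(u) = Σ_{m=0}^{n} (n!/m!)·C(n+1,m+1)·u^m·f^{(n+m+1)}(u), where f^{(r)} denotes the r-th iterated derivative and C(·,·) the binomial coefficient. -/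
open scoped BigOperators
open Matrix Polynomial Filter


/-- The Bessel-type differential operator `(B g)(u) = u g''(u) + g'(u)`. -/
noncomputable def Bop (g : ℝ → ℝ) : ℝ → ℝ := fun u => u * iteratedDeriv 2 g u + deriv g u

noncomputable def auxS (f : ℝ → ℝ) (n : ℕ) (u : ℝ) : ℝ :=
  ∑ m ∈ Finset.range (n + 1),
    ((n.factorial : ℝ) / (m.factorial : ℝ)) * (n.choose m : ℝ) * u ^ m *
      iteratedDeriv (n + m) f u

noncomputable def auxD (f : ℝ → ℝ) (n : ℕ) (u : ℝ) : ℝ :=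
  ∑ m ∈ Finset.range (n + 1),
    ((n.factorial : ℝ) / (m.factorial : ℝ)) * ((n + 1).choose (m + 1) : ℝ) * u ^ m *
      iteratedDeriv (n + m + 1) f u

lemma aux_iter (f : ℝ → ℝ) (hf : ContDiff ℝ (⊤ : ℕ∞) f) (k : ℕ) (u : ℝ) :
    HasDerivAt (iteratedDeriv k f) (iteratedDeriv (k + 1) f u) u := by
  rw [iteratedDeriv_succ]
  apply DifferentiableAt.hasDerivAt
  exact (hf.differentiable_iteratedDeriv k (by exact_mod_cast WithTop.coe_lt_top k)) u

lemma auxS_deriv (f : ℝ → ℝ) (hf : ContDiff ℝ (⊤ : ℕ∞) f) (n : ℕ) (u : ℝ) :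
    HasDerivAt (auxS f n) (auxD f n u) u := by
  have h : HasDerivAt (auxS f n) (∑ m ∈ Finset.range (n + 1),
      (((n.factorial : ℝ) / (m.factorial : ℝ)) * (n.choose m : ℝ) * ((m : ℝ) * u ^ (m - 1)) *
        iteratedDeriv (n + m) f u +
       ((n.factorial : ℝ) / (m.factorial : ℝ)) * (n.choose m : ℝ) * u ^ m *
        iteratedDeriv (n + m + 1) f u)) u := by
    unfold auxS
    refine HasDerivAt.fun_sum fun m _ => ?_
    exact ((hasDerivAt_pow m u).const_mul _).mul (aux_iter f hf (n + m) u)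
  convert h using 1
  unfold auxD
  symm
  rw [Finset.sum_add_distrib, Finset.sum_range_succ']
  have h0 : ∑ k ∈ Finset.range n, ((n.factorial : ℝ) / ((k+1).factorial : ℝ)) *
      (n.choose (k+1) : ℝ) * (((k + 1 : ℕ) : ℝ) * u ^ (k + 1 - 1)) *
        iteratedDeriv (n + (k + 1)) f u =
      ∑ k ∈ Finset.range (n + 1), ((n.factorial : ℝ) / ((k+1).factorial : ℝ)) *
      (n.choose (k+1) : ℝ) * (((k + 1 : ℕ) : ℝ) * u ^ (k + 1 - 1)) *
        iteratedDeriv (n + (k + 1)) f u := by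
    rw [Finset.sum_range_succ _ n]
    simp
  rw [h0]
  simp only [Nat.cast_zero, zero_mul, mul_zero, add_zero]
  rw [← Finset.sum_add_distrib]
  refine Finset.sum_congr rfl fun m _ => ?_
  rw [Nat.choose_succ_succ, Nat.factorial_succ, ← add_assoc, Nat.add_sub_cancel]
  have : (m.factorial : ℝ) ≠ 0 := by exact_mod_cast m.factorial_ne_zero
  have : (m : ℝ) + 1 ≠ 0 := by positivity
  push_cast
  field_simp
  ring

lemma auxD_deriv (f : ℝ → ℝ) (hf : ContDiff ℝ (⊤ : ℕ∞) f) (n : ℕ) (u : ℝ) :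
    HasDerivAt (fun u => u * auxD f n u) (auxS f (n + 1) u) u := by
  have h : HasDerivAt (fun u => u * auxD f n u) (∑ m ∈ Finset.range (n + 1),
      (((n.factorial : ℝ) / (m.factorial : ℝ)) * ((n + 1).choose (m + 1) : ℝ) *
        (((m + 1 : ℕ) : ℝ) * u ^ m) * iteratedDeriv (n + m + 1) f u +
       ((n.factorial : ℝ) / (m.factorial : ℝ)) * ((n + 1).choose (m + 1) : ℝ) * u ^ (m + 1) *
        iteratedDeriv (n + m + 1 + 1) f u)) u := by
    have e : (fun u => u * auxD f n u) = fun u => ∑ m ∈ Finset.range (n + 1),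
      ((n.factorial : ℝ) / (m.factorial : ℝ)) * ((n + 1).choose (m + 1) : ℝ) * u ^ (m + 1) *
        iteratedDeriv (n + m + 1) f u := by
      funext u
      unfold auxD
      rw [Finset.mul_sum]
      exact Finset.sum_congr rfl fun m _ => by ring
    rw [e]
    refine HasDerivAt.fun_sum fun m _ => ?_
    exact ((hasDerivAt_pow (m + 1) u).const_mul _).mul (aux_iter f hf (n + m + 1) u)
  convert h using 1
  rw [Finset.sum_add_distrib]
  have hA : ∑ m ∈ Finset.range (n + 1),
      ((n.factorial : ℝ) / (m.factorial : ℝ)) * ((n + 1).choose (m + 1) : ℝ) *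
        (((m + 1 : ℕ) : ℝ) * u ^ m) * iteratedDeriv (n + m + 1) f u =
      ∑ m ∈ Finset.range (n + 1 + 1),
      ((n.factorial : ℝ) / (m.factorial : ℝ)) * ((n + 1).choose (m + 1) : ℝ) *
        (((m + 1 : ℕ) : ℝ) * u ^ m) * iteratedDeriv (n + m + 1) f u := by
    rw [Finset.sum_range_succ _ (n + 1)]
    simp
  have hB : ∑ m ∈ Finset.range (n + 1),
      ((n.factorial : ℝ) / (m.factorial : ℝ)) * ((n + 1).choose (m + 1) : ℝ) * u ^ (m + 1) *
        iteratedDeriv (n + m + 1 + 1) f u =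
      ∑ m ∈ Finset.range (n + 1 + 1),
      ((n.factorial : ℝ) / (m.factorial : ℝ)) * (m : ℝ) * ((n + 1).choose m : ℝ) * u ^ m *
        iteratedDeriv (n + m + 1) f u := by
    rw [Finset.sum_range_succ' _ (n + 1)]
    simp only [Nat.cast_zero, zero_mul, mul_zero, add_zero]
    refine Finset.sum_congr rfl fun m _ => ?_
    rw [Nat.factorial_succ, ← add_assoc n m 1]
    have : (m.factorial : ℝ) ≠ 0 := by exact_mod_cast m.factorial_ne_zero
    have : (m : ℝ) + 1 ≠ 0 := by positivity
    push_cast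
    field_simp
  rw [hA, hB, ← Finset.sum_add_distrib]
  unfold auxS
  refine Finset.sum_congr rfl fun m hm => ?_
  have hm' : m ≤ n + 1 := by
    have := Finset.mem_range.mp hm
    omega
  have hc : ((n + 1).choose (m + 1) : ℝ) * ((m : ℝ) + 1) =
      ((n + 1).choose m : ℝ) * ((n : ℝ) + 1 - m) := by
    have := Nat.choose_succ_right_eq (n + 1) m
    have h2 : (((n + 1).choose (m + 1) * (m + 1) : ℕ) : ℝ) =
      (((n + 1).choose m * (n + 1 - m) : ℕ) : ℝ) := by rw [this]
    rw [Nat.cast_mul, Nat.cast_mul, Nat.cast_sub hm'] at h2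
    push_cast at h2
    exact h2
  rw [Nat.factorial_succ, show n + 1 + m = n + m + 1 by omega]
  push_cast
  linear_combination (-(n.factorial : ℝ) / (m.factorial : ℝ) * u ^ m *
    iteratedDeriv (n + m + 1) f u) * hc

lemma auxD_differentiable (f : ℝ → ℝ) (hf : ContDiff ℝ (⊤ : ℕ∞) f) (n : ℕ) (u : ℝ) :
    DifferentiableAt ℝ (auxD f n) u := by
  unfold auxD
  refine DifferentiableAt.fun_sum fun m _ => ?_
  exact (((hasDerivAt_pow m u).const_mul _).mul
    (aux_iter f hf (n + m + 1) u)).differentiableAt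

lemma aux_iterate (f : ℝ → ℝ) (hf : ContDiff ℝ (⊤ : ℕ∞) f) (n : ℕ) :
    Bop^[n] f = auxS f n := by
  induction n with
  | zero =>
    funext u
    simp [auxS]
  | succ n ih =>
    rw [Function.iterate_succ_apply', ih]
    have hd : deriv (auxS f n) = auxD f n := funext fun u => (auxS_deriv f hf n u).deriv
    funext u
    have h1 := (hasDerivAt_id' u).mul (auxD_differentiable f hf n u).hasDerivAt
    have h2 := h1.unique (auxD_deriv f hf n u)
    unfold Bop
    rw [iteratedDeriv_succ, iteratedDeriv_one, hd, ← h2]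
    ring

/-- iterations of the Bessel differential operator. -/
theorem bessel_operator_iterate (n : ℕ) (f : ℝ → ℝ) (hf : ContDiff ℝ (⊤ : ℕ∞) f) (u : ℝ) :
    (Bop^[n] f u =
      ∑ m ∈ Finset.range (n + 1),
        ((n.factorial : ℝ) / (m.factorial : ℝ)) * (n.choose m : ℝ) * u ^ m *
          iteratedDeriv (n + m) f u) ∧
    deriv (Bop^[n] f) u =
      ∑ m ∈ Finset.range (n + 1),
        ((n.factorial : ℝ) / (m.factorial : ℝ)) * ((n + 1).choose (m + 1) : ℝ) * u ^ m *
          iteratedDeriv (n + m + 1) f u := by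
  rw [aux_iterate f hf n]
  exact ⟨rfl, (auxS_deriv f hf n u).deriv⟩
end

section
/- (Sum rules for Bessel moments at even thresholds.) Let k ≥ 2 and s ∈ {1,…,k}. Then for every ℓ ∈ {1,…,⌊k/2⌋} the following hold at u = (2s)²: (i) (2k+1)·μ̆ℓ_{k,1}(u) + Σ_{j=1}^{⌊(k−s)/2⌋} (−1)^j·C(k−s,2j)·μ̆ℓ_{k,2j+1}(u) + Σ_{j=1}^{⌊(k−1+s)/2⌋} (−1)^j·(C(k−s,2j+1)+C(k+s,2j+1))·μ̆ℓ_{k,2j+k}(u) = 0; (ii) Σ_{j=0}^{⌊(k−1−s)/2⌋} (−1)^j·C(k−s,2j+1)·μ̆ℓ_{k,2j+2}(u) − Σ_{j=1}^{⌊(k+s)/2⌋} (−1)^j·(C(k−s,2j)−C(k+s,2j))·μ̆ℓ_{k,2j+k−1}(u) = 0. Moreover, for every ℓ ∈ {1,…,⌊(k−1)/2⌋} the same two identities hold with every μ̆ replaced by the differentiated moment μ̆́. (Empty sums are zero.) -/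
open scoped BigOperators
open Matrix Polynomial Filter

/-- The modified Bessel function `I₀`. -/
noncomputable def besselI0 (t : ℝ) : ℝ :=
  (1 / Real.pi) * ∫ θ in (0:ℝ)..Real.pi, Real.exp (t * Real.cos θ)

/-- The modified Bessel function `K₀`. -/
noncomputable def besselK0 (t : ℝ) : ℝ :=
  ∫ v in Set.Ioi (0:ℝ), Real.exp (-(t * Real.cosh v))

/-- `I₁ = I₀'`. -/
noncomputable def besselI1 : ℝ → ℝ := deriv besselI0

/-- `K₁ = -K₀'`. -/
noncomputable def besselK1 : ℝ → ℝ := fun t => -(deriv besselK0 t)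

/-- Off-shell Bessel moment `IvKM(a,b;n|u)`. -/
noncomputable def IvKM (a b n : ℕ) (u : ℝ) : ℝ :=
  ∫ t in Set.Ioi (0:ℝ),
    besselI0 (Real.sqrt u * t) * besselI0 t ^ (a - 1) * besselK0 t ^ b * t ^ n

/-- Off-shell Bessel moment `IKvM(a,b;n|u)`. -/
noncomputable def IKvM (a b n : ℕ) (u : ℝ) : ℝ :=
  ∫ t in Set.Ioi (0:ℝ),
    besselK0 (Real.sqrt u * t) * besselI0 t ^ a * besselK0 t ^ (b - 1) * t ^ n

/-- Differentiated Bessel moment `IpKM(a,b;n|u)`. -/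
noncomputable def IpKM (a b n : ℕ) (u : ℝ) : ℝ :=
  ∫ t in Set.Ioi (0:ℝ),
    besselI1 (Real.sqrt u * t) * besselI0 t ^ (a - 1) * besselK0 t ^ b * t ^ (n + 1)

/-- Differentiated Bessel moment `IKpM(a,b;n|u)`. -/
noncomputable def IKpM (a b n : ℕ) (u : ℝ) : ℝ :=
  -∫ t in Set.Ioi (0:ℝ),
    besselK1 (Real.sqrt u * t) * besselI0 t ^ a * besselK0 t ^ (b - 1) * t ^ (n + 1)

/-- The normalized off-shell Bessel moments `μ̆ℓ_{k,j}(u)` (for `1 ≤ j ≤ 3k-1`). -/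
noncomputable def muS (k l j : ℕ) (u : ℝ) : ℝ :=
  if j = 1 then
    Real.pi ^ (-(k : ℤ)) *
      ((IvKM 1 (2 * k) (2 * l - 1) u + (2 * k : ℝ) * IKvM 1 (2 * k) (2 * l - 1) u) / (2 * k + 1))
  else if j ≤ k then
    Real.pi ^ ((j : ℤ) - k - 1) * IvKM j (2 * k + 1 - j) (2 * l - 1) u
  else
    Real.pi ^ ((j : ℤ) - 2 * k) * IKvM (j - k + 1) (3 * k - j) (2 * l - 1) u

/-- The normalized differentiated Bessel moments `μ̆́ℓ_{k,j}(u)`. -/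
noncomputable def muSp (k l j : ℕ) (u : ℝ) : ℝ :=
  if j = 1 then
    Real.pi ^ (-(k : ℤ)) *
      ((IpKM 1 (2 * k) (2 * l - 1) u + (2 * k : ℝ) * IKpM 1 (2 * k) (2 * l - 1) u) / (2 * k + 1))
  else if j ≤ k then
    Real.pi ^ ((j : ℤ) - k - 1) * IpKM j (2 * k + 1 - j) (2 * l - 1) u
  else
    Real.pi ^ ((j : ℤ) - 2 * k) * IKpM (j - k + 1) (3 * k - j) (2 * l - 1) u


section BesselAux

open MeasureTheory Set Topology

/-- Base integrability with algebraic singularities at `0` and `2`. -/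
lemma bm_base_integrable {δ : ℝ} (h0 : 0 < δ) (h1 : δ < 1 / 2) :
    IntegrableOn (fun y : ℝ => y ^ (-(1/2) - δ : ℝ) * |2 - y| ^ (-(1/2) : ℝ)) (Ioi 0) := by
  have hm : Measurable (fun y : ℝ => y ^ (-(1/2) - δ : ℝ) * |2 - y| ^ (-(1/2) : ℝ)) := by
    fun_prop
  have e : Ioi (0:ℝ) = Ioc 0 1 ∪ (Ioc 1 2 ∪ (Ioc 2 3 ∪ Ioi 3)) := by
    rw [Ioc_union_Ioi_eq_Ioi (by norm_num), Ioc_union_Ioi_eq_Ioi (by norm_num),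
      Ioc_union_Ioi_eq_Ioi (by norm_num)]
  rw [e]
  refine IntegrableOn.union ?_ (IntegrableOn.union ?_ (IntegrableOn.union ?_ ?_))
  · have h := (intervalIntegral.intervalIntegrable_rpow' (a := 0) (b := 1)
      (r := -(1/2) - δ) (by linarith)).1
    refine Integrable.mono' h hm.aestronglyMeasurable ?_
    filter_upwards [ae_restrict_mem measurableSet_Ioc] with y hy
    rw [Real.norm_of_nonneg (mul_nonneg (Real.rpow_nonneg hy.1.le _) (Real.rpow_nonneg (abs_nonneg _) _))]
    refine mul_le_of_le_one_right (Real.rpow_nonneg hy.1.le _) ?_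
    apply Real.rpow_le_one_of_one_le_of_nonpos
    · rw [abs_of_nonneg] <;> linarith [hy.2]
    · norm_num
  · have h := ((intervalIntegral.intervalIntegrable_rpow' (a := 1) (b := 0)
      (r := -(1/2)) (by norm_num)).comp_sub_left 2).1
    norm_num at h
    refine Integrable.mono' (g := fun x => (2 - x) ^ (-(1/2) : ℝ)) (by simpa [IntegrableOn] using h) hm.aestronglyMeasurable ?_
    filter_upwards [ae_restrict_mem measurableSet_Ioc] with y hy
    have hy0 : 0 ≤ y := by linarith [hy.1]
    rw [Real.norm_of_nonneg (mul_nonneg (Real.rpow_nonneg hy0 _) (Real.rpow_nonneg (abs_nonneg _) _)),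
      abs_of_nonneg (by linarith [hy.2])]
    refine mul_le_of_le_one_left (Real.rpow_nonneg (by linarith [hy.2]) _) ?_
    exact Real.rpow_le_one_of_one_le_of_nonpos hy.1.le (by linarith)
  · have h := ((intervalIntegral.intervalIntegrable_rpow' (a := 0) (b := 1)
      (r := -(1/2)) (by norm_num)).comp_sub_right 2).1
    norm_num at h
    refine Integrable.mono' (g := fun x => (x - 2) ^ (-(1/2) : ℝ)) (by simpa [IntegrableOn] using h) hm.aestronglyMeasurable ?_
    filter_upwards [ae_restrict_mem measurableSet_Ioc] with y hy
    have hy0 : 0 ≤ y := by linarith [hy.1]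
    rw [Real.norm_of_nonneg (mul_nonneg (Real.rpow_nonneg hy0 _) (Real.rpow_nonneg (abs_nonneg _) _)),
      abs_sub_comm, abs_of_nonneg (by linarith [hy.1])]
    refine mul_le_of_le_one_left (Real.rpow_nonneg (by linarith [hy.1]) _) ?_
    exact Real.rpow_le_one_of_one_le_of_nonpos (by linarith [hy.1]) (by linarith)
  · have h := (integrableOn_Ioi_rpow_of_lt (a := -1 - δ) (c := 3) (by linarith) (by norm_num)).const_mul
      ((1/3:ℝ) ^ (-(1/2) : ℝ))
    refine Integrable.mono' h hm.aestronglyMeasurable ?_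
    filter_upwards [ae_restrict_mem measurableSet_Ioi] with y hy
    have hy' : 3 < y := hy
    have hy0 : 0 < y := by linarith
    rw [Real.norm_of_nonneg (mul_nonneg (Real.rpow_nonneg hy0.le _) (Real.rpow_nonneg (abs_nonneg _) _)),
      abs_sub_comm, abs_of_nonneg (by linarith)]
    have h2 : (y - 2) ^ (-(1/2) : ℝ) ≤ (1/3 * y) ^ (-(1/2) : ℝ) :=
      Real.rpow_le_rpow_of_nonpos (by positivity) (by linarith) (by norm_num)
    rw [Real.mul_rpow (by norm_num) hy0.le] at h2
    calc _ ≤ y ^ (-(1/2) - δ : ℝ) * ((1/3:ℝ) ^ (-(1/2) : ℝ) * y ^ (-(1/2) : ℝ)) := by gcongr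
      _ = (1/3:ℝ) ^ (-(1/2) : ℝ) * (y ^ (-(1/2) - δ : ℝ) * y ^ (-(1/2) : ℝ)) := by ring
      _ = _ := by rw [← Real.rpow_add hy0]; congr 2; ring

/-- Dominating density. -/
noncomputable def bmg (m : ℕ) (ρ y : ℝ) : ℝ :=
  Real.exp (-(ρ * y)) * y ^ (-(1/2) : ℝ) * (1 + y) ^ m * |2 - y| ^ (-(1/2) : ℝ)

/-- Dominating integral. -/
noncomputable def bmN (m : ℕ) (ρ : ℝ) : ℝ := ∫ y in Ioi (0:ℝ), bmg m ρ y

lemma bm_exp_aux {δ x : ℝ} (h0 : 0 < δ) (h1 : δ < 1 / 2) (hx : 0 < x) :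
    Real.exp (-x) ≤ x ^ (-δ) ∧ x * Real.exp (-x) ≤ 2 * x ^ (-δ) := by
  have hq := Real.quadratic_le_exp_of_nonneg hx.le
  have hl : x ≤ Real.exp x := by linarith [Real.add_one_le_exp x]
  have h1e : 1 ≤ Real.exp x := Real.one_le_exp hx.le
  have hxd : x ^ δ ≤ Real.exp x := by
    rcases le_total x 1 with h | h
    · exact (Real.rpow_le_one hx.le h h0.le).trans h1e
    · exact (Real.rpow_le_self_of_one_le h (by linarith)).trans hl
  have hxd2 : x * x ^ δ ≤ 2 * Real.exp x := by
    rcases le_total x 1 with h | h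
    · have := Real.rpow_le_one hx.le h h0.le
      nlinarith
    · have := Real.rpow_le_self_of_one_le h (by linarith : δ ≤ 1)
      nlinarith
  have hp : 0 < x ^ δ := Real.rpow_pos_of_pos hx δ
  rw [Real.exp_neg, Real.rpow_neg hx.le]
  have he := Real.exp_pos x
  refine ⟨by gcongr, ?_⟩
  rw [← div_eq_mul_inv, ← div_eq_mul_inv, div_le_div_iff₀ he hp]
  exact hxd2

lemma bmg_le {m : ℕ} (hm : m ≤ 1) {δ ρ y : ℝ} (h0 : 0 < δ) (h1 : δ < 1 / 2) (hρ : 0 < ρ)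
    (hy : 0 < y) :
    bmg m ρ y ≤ (ρ ^ m)⁻¹ * (ρ + 2) ^ m * ρ ^ (-δ) * (y ^ (-(1/2) - δ : ℝ) * |2 - y| ^ (-(1/2) : ℝ)) := by
  obtain ⟨e1, e2⟩ := bm_exp_aux h0 h1 (mul_pos hρ hy)
  rw [Real.mul_rpow hρ.le hy.le] at e1 e2
  have key : Real.exp (-(ρ * y)) * (1 + y) ^ m ≤ (ρ ^ m)⁻¹ * (ρ + 2) ^ m * (ρ ^ (-δ) * y ^ (-δ)) := by
    interval_cases m
    · simpa using e1
    · rw [pow_one, pow_one, pow_one, mul_assoc, ← div_eq_inv_mul, le_div_iff₀ hρ]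
      nlinarith
  have hA : 0 ≤ y ^ (-(1/2) : ℝ) * |2 - y| ^ (-(1/2) : ℝ) := by positivity
  calc bmg m ρ y = (Real.exp (-(ρ * y)) * (1 + y) ^ m) * (y ^ (-(1/2) : ℝ) * |2 - y| ^ (-(1/2) : ℝ)) := by
        unfold bmg; ring
    _ ≤ _ := mul_le_mul_of_nonneg_right key hA
    _ = _ := by rw [sub_eq_add_neg (-(1/2) : ℝ) δ, Real.rpow_add hy]; ring

lemma bmg_nonneg (m : ℕ) (ρ : ℝ) {y : ℝ} (hy : 0 < y) : 0 ≤ bmg m ρ y := by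
  unfold bmg; positivity

lemma bmg_integrable {m : ℕ} (hm : m ≤ 1) {ρ : ℝ} (hρ : 0 < ρ) :
    IntegrableOn (bmg m ρ) (Ioi 0) := by
  refine Integrable.mono' ((bm_base_integrable (δ := 1/4) (by norm_num) (by norm_num)).const_mul
    ((ρ ^ m)⁻¹ * (ρ + 2) ^ m * ρ ^ (-(1/4) : ℝ))) ?_ ?_
  · unfold bmg; exact Measurable.aestronglyMeasurable (by fun_prop)
  · filter_upwards [ae_restrict_mem measurableSet_Ioi] with y hy
    rw [Real.norm_of_nonneg (bmg_nonneg m ρ hy)]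
    exact bmg_le hm (by norm_num) (by norm_num) hρ hy

lemma bmN_nonneg (m : ℕ) (ρ : ℝ) : 0 ≤ bmN m ρ :=
  setIntegral_nonneg measurableSet_Ioi fun _ hy => bmg_nonneg m ρ hy

lemma bmN_le {m : ℕ} (hm : m ≤ 1) {δ : ℝ} (h0 : 0 < δ) (h1 : δ < 1 / 2) :
    ∃ C : ℝ, 0 ≤ C ∧ ∀ ρ : ℝ, 0 < ρ → ρ ^ m * bmN m ρ ≤ C * ((ρ + 2) ^ m * ρ ^ (-δ)) := by
  refine ⟨∫ y in Ioi (0:ℝ), y ^ (-(1/2) - δ : ℝ) * |2 - y| ^ (-(1/2) : ℝ),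
    setIntegral_nonneg measurableSet_Ioi fun y hy => ?_, fun ρ hρ => ?_⟩
  · have : (0:ℝ) < y := hy
    positivity
  · have := setIntegral_mono_on (bmg_integrable hm hρ)
      ((bm_base_integrable h0 h1).const_mul ((ρ ^ m)⁻¹ * (ρ + 2) ^ m * ρ ^ (-δ))) measurableSet_Ioi
      fun y hy => bmg_le hm h0 h1 hρ hy
    rw [integral_const_mul] at this
    have hp : 0 < ρ ^ m := by positivity
    calc ρ ^ m * bmN m ρ ≤ _ := mul_le_mul_of_nonneg_left this hp.le
      _ = _ := by field_simp


/-- Rotated integrand. -/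
noncomputable def bmH (m : ℕ) (ρ : ℝ) (E : ℂ) (y : ℝ) : ℂ :=
  ((Real.exp (-(ρ * y)) * y ^ (-(1/2) : ℝ) : ℝ) : ℂ) * (1 + y * E) ^ m *
    (2 + y * E) ^ ((-(1/2) : ℝ) : ℂ)

/-- Unit direction. -/
noncomputable def bmE (w : ℂ) : ℂ := Complex.exp ((-w.im : ℝ) * Complex.I)

/-- `K_m(e^w)` on the strip `-π ≤ Im w ≤ 0`. -/
noncomputable def bmk (m : ℕ) (w : ℂ) : ℂ :=
  Complex.exp (-Complex.exp w) * Complex.exp ((-w.im / 2 : ℝ) * Complex.I) *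
    ∫ y in Ioi (0:ℝ), bmH m (Real.exp w.re) (bmE w) y

lemma bmE_norm (w : ℂ) : ‖bmE w‖ = 1 := Complex.norm_exp_ofReal_mul_I _

lemma bm_norm_ge {E : ℂ} (hE : ‖E‖ = 1) {y : ℝ} (hy : 0 < y) : |2 - y| ≤ ‖2 + y * E‖ := by
  have h := abs_norm_sub_norm_le (2:ℂ) (-(y * E))
  simpa [hE, abs_of_pos hy] using h

lemma bmH_norm_le (m : ℕ) (ρ : ℝ) {E : ℂ} (hE : ‖E‖ = 1) {y : ℝ} (hy : 0 < y) (hy2 : y ≠ 2) :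
    ‖bmH m ρ E y‖ ≤ bmg m ρ y := by
  unfold bmH bmg
  rw [norm_mul, norm_mul, Complex.norm_cpow_real, norm_pow, Complex.norm_real,
    Real.norm_of_nonneg (by positivity)]
  have h1 : ‖1 + y * E‖ ≤ 1 + y := by
    refine (norm_add_le _ _).trans ?_
    simp [hE, abs_of_pos hy]
  have h2 : ‖2 + y * E‖ ^ (-(1/2) : ℝ) ≤ |2 - y| ^ (-(1/2) : ℝ) :=
    Real.rpow_le_rpow_of_nonpos (abs_pos.2 (sub_ne_zero.2 hy2.symm)) (bm_norm_ge hE hy) (by norm_num)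
  gcongr

lemma bm_ae (P : ℝ → Prop) (h : ∀ y, 0 < y → y ≠ 2 → P y) : ∀ᵐ y ∂(volume.restrict (Ioi (0:ℝ))), P y := by
  have h2 : ∀ᵐ y ∂(volume.restrict (Ioi (0:ℝ))), y ≠ 2 :=
    ae_restrict_of_ae (by simp [ae_iff])
  filter_upwards [h2, ae_restrict_mem measurableSet_Ioi] with y hy hy0 using h y hy0 hy

lemma bmH_meas (m : ℕ) (ρ : ℝ) (E : ℂ) : Measurable (bmH m ρ E) := by
  unfold bmH
  fun_prop

lemma bmk_norm_le {m : ℕ} (hm : m ≤ 1) (w : ℂ) :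
    ‖bmk m w‖ ≤ Real.exp (-(Real.exp w.re * Real.cos w.im)) * bmN m (Real.exp w.re) := by
  unfold bmk
  rw [norm_mul, norm_mul, Complex.norm_exp_ofReal_mul_I, mul_one, Complex.norm_exp, Complex.neg_re,
    Complex.exp_re]
  refine mul_le_mul_of_nonneg_left ?_ (Real.exp_pos _).le
  refine norm_integral_le_of_norm_le (bmg_integrable hm (Real.exp_pos _)) (bm_ae _ ?_)
  intro y hy hy2
  exact bmH_norm_le m _ (bmE_norm w) hy hy2

/-- The closed strip. -/
def bmS : Set ℂ := {w | -Real.pi ≤ w.im ∧ w.im ≤ 0}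

lemma bmE_im (w : ℂ) (hw : w ∈ bmS) : 0 ≤ (bmE w).im := by
  unfold bmE
  rw [Complex.exp_ofReal_mul_I_im]
  exact Real.sin_nonneg_of_nonneg_of_le_pi (by linarith [hw.2]) (by linarith [hw.1])

lemma bm_cpow_cont {p : ℂ} (hp : p ≠ 0) :
    ContinuousWithinAt (fun z : ℂ => z ^ ((-(1/2) : ℝ) : ℂ)) {z | 0 ≤ z.im} p := by
  by_cases hs : p ∈ Complex.slitPlane
  · exact (continuousAt_cpow_const hs).continuousWithinAt
  · rw [Complex.mem_slitPlane_iff, not_or, not_lt, not_not] at hs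
    have hre : p.re < 0 := lt_of_le_of_ne hs.1 fun h => hp (Complex.ext h hs.2)
    have hl := Complex.continuousWithinAt_log_of_re_neg_of_im_zero hre hs.2
    have h2 : ContinuousWithinAt (fun z : ℂ => Complex.exp (Complex.log z * ((-(1/2) : ℝ) : ℂ)))
      {z | 0 ≤ z.im} p := (hl.mul_const _).cexp
    refine h2.congr_of_eventuallyEq ?_ (Complex.cpow_def_of_ne_zero hp _)
    have : ∀ᶠ z in 𝓝[{z : ℂ | 0 ≤ z.im}] p, z ≠ 0 := nhdsWithin_le_nhds (isOpen_ne.mem_nhds hp)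
    filter_upwards [this] with z hz using Complex.cpow_def_of_ne_zero hz _

lemma bmE_continuous : Continuous bmE := by unfold bmE; fun_prop

lemma bmk_continuousOn {m : ℕ} (hm : m ≤ 1) : ContinuousOn (bmk m) bmS := by
  intro w0 hw0
  have h1 : Continuous fun w : ℂ => Complex.exp (-Complex.exp w) * Complex.exp ((-w.im / 2 : ℝ) * Complex.I) := by
    fun_prop
  refine h1.continuousWithinAt.mul ?_
  refine continuousWithinAt_of_dominated (bound := bmg m (Real.exp w0.re / 2)) ?_ ?_
    (bmg_integrable hm (by positivity)) ?_
  · exact Eventually.of_forall fun w => (bmH_meas _ _ _).aestronglyMeasurable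
  · have : ∀ᶠ w : ℂ in 𝓝[bmS] w0, Real.exp w0.re / 2 < Real.exp w.re := by
      have hc : ContinuousAt (fun w : ℂ => Real.exp w.re) w0 := by fun_prop
      exact nhdsWithin_le_nhds (hc.eventually (lt_mem_nhds (by linarith [Real.exp_pos w0.re])))
    filter_upwards [this] with w hw
    refine bm_ae _ fun y hy hy2 => (bmH_norm_le m _ (bmE_norm w) hy hy2).trans ?_
    unfold bmg
    gcongr
  · refine bm_ae _ fun y hy hy2 => ?_
    unfold bmH
    have hp : (2 + y * bmE w0) ≠ 0 := by
      intro h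
      have := bm_norm_ge (bmE_norm w0) hy
      rw [h, norm_zero] at this
      exact hy2 (by linarith [abs_nonpos_iff.1 this])
    have hEc := bmE_continuous
    have a1 : Continuous fun w : ℂ => ((Real.exp (-(Real.exp w.re * y)) * y ^ (-(1/2) : ℝ) : ℝ) : ℂ) *
        (1 + y * bmE w) ^ m := by fun_prop
    refine a1.continuousWithinAt.mul ?_
    have im0 : ∀ w ∈ bmS, 0 ≤ (2 + y * bmE w).im := fun w hw => by
      simpa using mul_nonneg hy.le (bmE_im w hw)
    have a2 : Continuous fun w : ℂ => 2 + (y:ℂ) * bmE w := by fun_prop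
    have a3 := bm_cpow_cont hp
    have a4 : Tendsto (fun w : ℂ => 2 + (y:ℂ) * bmE w) (𝓝[bmS] w0)
        (𝓝[{z : ℂ | 0 ≤ z.im}] (2 + (y:ℂ) * bmE w0)) :=
      tendsto_nhdsWithin_iff.2 ⟨a2.continuousWithinAt, eventually_mem_nhdsWithin.mono im0⟩
    exact Tendsto.comp a3 a4

/-- Integrand for the analytic representation. -/
noncomputable def bmF (m : ℕ) (w : ℂ) (x : ℝ) : ℂ :=
  ((Real.exp (-x) * x ^ (-(1/2) : ℝ) : ℝ) : ℂ) * (1 + x * Complex.exp (-w)) ^ m *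
    (2 + x * Complex.exp (-w)) ^ ((-(1/2) : ℝ) : ℂ)

lemma bmk_eq (m : ℕ) (w : ℂ) :
    bmk m w = Complex.exp (-Complex.exp w) * Complex.exp (-w / 2) *
      ∫ x in Ioi (0:ℝ), bmF m w x := by
  have hr : (0:ℝ) < Real.exp w.re := Real.exp_pos _
  have h := integral_comp_mul_left_Ioi (bmF m w) 0 hr
  rw [mul_zero] at h
  have hexp : (Real.exp w.re : ℂ) * Complex.exp (-w) = bmE w := by
    unfold bmE
    rw [Complex.ofReal_exp, ← Complex.exp_add]
    congr 1
    apply Complex.ext <;> simp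
  have h3 : ∀ y ∈ Ioi (0:ℝ), bmF m w (Real.exp w.re * y) =
      ((Real.exp w.re ^ (-(1/2) : ℝ) : ℝ) : ℂ) * bmH m (Real.exp w.re) (bmE w) y := by
    intro y hy
    unfold bmF bmH
    rw [← hexp, Real.mul_rpow hr.le (le_of_lt hy)]
    push_cast
    ring_nf
  rw [setIntegral_congr_fun measurableSet_Ioi h3, integral_const_mul] at h
  have h4 : ∫ x in Ioi (0:ℝ), bmF m w x = (Real.exp w.re : ℂ) *
      (((Real.exp w.re ^ (-(1/2) : ℝ) : ℝ) : ℂ) * ∫ y in Ioi (0:ℝ), bmH m (Real.exp w.re) (bmE w) y) := by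
    rw [h, ← Complex.real_smul, smul_smul, mul_inv_cancel₀ hr.ne', one_smul]
  rw [h4]
  unfold bmk
  rw [← Real.exp_mul]
  have h5 : Complex.exp ((-w.im / 2 : ℝ) * Complex.I) = Complex.exp (-w / 2) * (Real.exp w.re : ℂ) *
      ((Real.exp (w.re * (-(1/2))) : ℝ) : ℂ) := by
    rw [Complex.ofReal_exp, Complex.ofReal_exp, ← Complex.exp_add, ← Complex.exp_add]
    congr 1
    apply Complex.ext
    · simp; ring
    · simp
  rw [h5]; ring

lemma bmF_diff (m : ℕ) {w : ℂ} (h1 : -Real.pi < w.im) (h2 : w.im < 0) {x : ℝ} (hx : 0 < x) :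
    HasDerivAt (fun w => bmF m w x) 
      (((Real.exp (-x) * x ^ (-(1/2) : ℝ) : ℝ) : ℂ) *
        ((m * (1 + x * Complex.exp (-w)) ^ (m-1) * (-(x * Complex.exp (-w)))) *
          (2 + x * Complex.exp (-w)) ^ ((-(1/2) : ℝ) : ℂ) +
        (1 + x * Complex.exp (-w)) ^ m * (((-(1/2) : ℝ) : ℂ) *
          (2 + x * Complex.exp (-w)) ^ (((-(1/2) : ℝ) : ℂ) - 1) * (-(x * Complex.exp (-w)))))) w := by
  have he : HasDerivAt (fun w : ℂ => (x:ℂ) * Complex.exp (-w)) (-(x * Complex.exp (-w))) w := by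
    have := ((hasDerivAt_id w).neg.cexp).const_mul (x:ℂ)
    simpa using this
  have hs : 2 + x * Complex.exp (-w) ∈ Complex.slitPlane := by
    rw [Complex.mem_slitPlane_iff]
    right
    have : 0 < Real.sin (-w.im) := Real.sin_pos_of_pos_of_lt_pi (by linarith) (by linarith)
    have h3 : (2 + x * Complex.exp (-w)).im = x * (Real.exp (-w.re) * Real.sin (-w.im)) := by
      simp [Complex.exp_im]
    rw [h3]; positivity
  have ha := (he.const_add 1).pow m
  have hb := (he.const_add 2).cpow_const (c := ((-(1/2) : ℝ) : ℂ)) hs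
  have := (ha.mul hb).const_mul ((Real.exp (-x) * x ^ (-(1/2) : ℝ) : ℝ) : ℂ)
  refine this.congr_of_eventuallyEq (Eventually.of_forall fun w => ?_)
  simp only [bmF, Pi.mul_apply, Pi.pow_apply, mul_assoc]

lemma bm_norm_ge2 {w : ℂ} {x : ℝ} :
    2 * |Real.sin w.im| ≤ ‖2 + x * Complex.exp (-w)‖ := by
  have h : (2 + x * Complex.exp (-w)) * Complex.exp w = 2 * Complex.exp w + x := by
    rw [add_mul, mul_assoc, ← Complex.exp_add]; simp
  have h2 := Complex.abs_im_le_norm (2 * Complex.exp w + x)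
  rw [← h, norm_mul, Complex.norm_exp, h] at h2
  have h3 : (2 * Complex.exp w + x).im = Real.exp w.re * (2 * Real.sin w.im) := by
    simp [Complex.exp_im]; ring
  rw [h3, abs_mul, abs_of_pos (Real.exp_pos _), mul_comm, abs_mul, abs_two] at h2
  exact le_of_mul_le_mul_right h2 (Real.exp_pos _)

lemma bm_exp_int (m : ℕ) (R : ℝ) (hR : 0 ≤ R) (hm : m ≤ 1) : IntegrableOn
    (fun x : ℝ => Real.exp (-x) * x ^ (-(1/2) : ℝ) * (1 + x * R) ^ m) (Ioi 0) := by
  have a : IntegrableOn (fun x : ℝ => Real.exp (-x) * x ^ (-(1/2) : ℝ)) (Ioi 0) := by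
    have := Real.GammaIntegral_convergent (s := 1/2) (by norm_num)
    norm_num at this ⊢
    exact this
  have b : IntegrableOn (fun x : ℝ => Real.exp (-x) * x ^ (1/2 : ℝ)) (Ioi 0) := by
    have := Real.GammaIntegral_convergent (s := 3/2) (by norm_num)
    norm_num at this ⊢
    exact this
  interval_cases m
  · simpa using a
  · refine (Integrable.add a (b.const_mul R)).congr ?_
    filter_upwards [ae_restrict_mem measurableSet_Ioi] with x hx
    have hx' : (0:ℝ) < x := hx
    have : x ^ (1/2 : ℝ) = x ^ (-(1/2) : ℝ) * x := by
      nth_rw 3 [← Real.rpow_one x]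
      rw [← Real.rpow_add hx']; norm_num
    simp only [Pi.add_apply, this]
    ring

lemma bmk_differentiableAt {m : ℕ} (hm : m ≤ 1) {w : ℂ} (h1 : -Real.pi < w.im) (h2 : w.im < 0) :
    DifferentiableAt ℂ (bmk m) w := by
  have e : bmk m = fun w => Complex.exp (-Complex.exp w) * Complex.exp (-w / 2) *
      ∫ x in Ioi (0:ℝ), bmF m w x := funext (bmk_eq m)
  rw [e]
  refine DifferentiableAt.mul (by fun_prop) ?_
  -- a ball around w
  have hsin : 0 < |Real.sin w.im| := by
    rw [abs_pos]
    have : 0 < Real.sin (-w.im) := Real.sin_pos_of_pos_of_lt_pi (by linarith) (by linarith)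
    rw [Real.sin_neg] at this
    linarith
  set c := |Real.sin w.im| / 2 with hc
  have hc0 : 0 < c := by positivity
  set R := Real.exp (-w.re + 1) 
  have hR0 : 0 < R := Real.exp_pos _
  have hopen : ∀ᶠ z : ℂ in 𝓝 w, -Real.pi < z.im ∧ z.im < 0 ∧ c < |Real.sin z.im| ∧
      Real.exp (-z.re) < R := by
    refine Eventually.and ?_ (Eventually.and ?_ (Eventually.and ?_ ?_))
    · exact Complex.continuous_im.continuousAt.eventually (lt_mem_nhds h1)
    · exact Complex.continuous_im.continuousAt.eventually (gt_mem_nhds h2)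
    · have : ContinuousAt (fun z : ℂ => |Real.sin z.im|) w := by fun_prop
      exact this.eventually (lt_mem_nhds (by linarith))
    · have : ContinuousAt (fun z : ℂ => Real.exp (-z.re)) w := by fun_prop
      exact this.eventually (gt_mem_nhds (Real.exp_lt_exp.2 (by linarith)))
  obtain ⟨r, hr, hball⟩ := Metric.eventually_nhds_iff_ball.1 hopen
  set D : ℝ := (2 * c) ^ (-(1/2) : ℝ) with hD
  have bd : ∀ x : ℝ, 0 < x → ∀ z ∈ Metric.ball w r, ‖bmF m z x‖ ≤
      Real.exp (-x) * x ^ (-(1/2) : ℝ) * (1 + x * R) ^ m * D := by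
    intro x hx z hz
    obtain ⟨-, -, b3, b4⟩ := hball z hz
    unfold bmF
    rw [norm_mul, norm_mul, Complex.norm_cpow_real, norm_pow, Complex.norm_real,
      Real.norm_of_nonneg (by positivity)]
    have n1 : ‖1 + x * Complex.exp (-z)‖ ≤ 1 + x * R := by
      refine (norm_add_le _ _).trans ?_
      rw [norm_one, norm_mul, Complex.norm_exp, Complex.norm_real, Real.norm_of_nonneg hx.le]
      gcongr
      simpa using b4.le
    have n2 : ‖2 + x * Complex.exp (-z)‖ ^ (-(1/2) : ℝ) ≤ D :=
      Real.rpow_le_rpow_of_nonpos (by positivity) (by linarith [bm_norm_ge2 (w := z) (x := x)]) (by norm_num)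
    gcongr
  have hintg := (bm_exp_int m R hR0.le hm).mul_const D
  have meas : ∀ z, Measurable (bmF m z) := fun z => by unfold bmF; fun_prop
  have key := hasDerivAt_integral_of_dominated_loc_of_deriv_le (μ := volume.restrict (Ioi (0:ℝ)))
    (F := bmF m) (F' := fun w x => (((Real.exp (-x) * x ^ (-(1/2) : ℝ) : ℝ) : ℂ) *
        ((m * (1 + x * Complex.exp (-w)) ^ (m-1) * (-(x * Complex.exp (-w)))) *
          (2 + x * Complex.exp (-w)) ^ ((-(1/2) : ℝ) : ℂ) +
        (1 + x * Complex.exp (-w)) ^ m * (((-(1/2) : ℝ) : ℂ) *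
          (2 + x * Complex.exp (-w)) ^ (((-(1/2) : ℝ) : ℂ) - 1) * (-(x * Complex.exp (-w)))))))
    (x₀ := w) (s := Metric.ball w (r/2))
    (bound := fun x => Real.exp (-x) * x ^ (-(1/2) : ℝ) * (1 + x * R) ^ m * D / (r/4))
    (Metric.ball_mem_nhds _ (by positivity))
    (Eventually.of_forall fun z => (meas z).aestronglyMeasurable) ?_ ?_ ?_ (hintg.div_const _) ?_
  · exact key.2.differentiableAt
  · refine Integrable.mono' hintg (meas w).aestronglyMeasurable ?_
    filter_upwards [ae_restrict_mem measurableSet_Ioi] with x hx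
    exact bd x hx w (Metric.mem_ball_self hr)
  · exact Measurable.aestronglyMeasurable (by fun_prop)
  · filter_upwards [ae_restrict_mem measurableSet_Ioi] with x hx z hz
    rw [Metric.mem_ball] at hz
    have hz' : z ∈ Metric.ball w r := by rw [Metric.mem_ball]; linarith
    obtain ⟨b1, b2, -, -⟩ := hball z hz'
    rw [← (bmF_diff m b1 b2 hx).deriv]
    have hsub : Metric.closedBall z (r/4) ⊆ Metric.ball w r := by
      intro v hv
      rw [Metric.mem_closedBall] at hv
      rw [Metric.mem_ball]
      linarith [dist_triangle v z w]
    refine Complex.norm_deriv_le_of_forall_mem_sphere_norm_le (by positivity) ?_ ?_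
    · refine DifferentiableOn.diffContOnCl fun v hv => ?_
      rw [closure_ball _ (by positivity)] at hv
      obtain ⟨b1, b2, -, -⟩ := hball v (hsub hv)
      exact (bmF_diff m b1 b2 hx).differentiableAt.differentiableWithinAt
    · intro v hv
      exact bd x hx v (hsub (Metric.sphere_subset_closedBall hv))
  · filter_upwards [ae_restrict_mem measurableSet_Ioi] with x hx z hz
    rw [Metric.mem_ball] at hz
    have hz' : z ∈ Metric.ball w r := by rw [Metric.mem_ball]; linarith
    obtain ⟨b1, b2, -, -⟩ := hball z hz'
    exact bmF_diff m b1 b2 hx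


/-- `K_m` for `m = 0, 1`. -/
noncomputable def bmK (m : ℕ) (t : ℝ) : ℝ :=
  ∫ v in Ioi (0:ℝ), Real.cosh v ^ m * Real.exp (-(t * Real.cosh v))

/-- `π I_m` for `m = 0, 1`. -/
noncomputable def bmI (m : ℕ) (t : ℝ) : ℝ :=
  ∫ a in (0:ℝ)..Real.pi, Real.cos a ^ m * Real.exp (t * Real.cos a)

lemma bm_image_cosh (c : ℝ) : (fun v => Real.cosh v - c) '' Ioi 0 = Ioi (1 - c) := by
  ext y
  constructor
  · rintro ⟨v, hv, rfl⟩
    have := Real.one_lt_cosh.2 (ne_of_gt hv)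
    simpa using this
  · intro hy
    have hy' : 1 < y + c := by have : 1 - c < y := hy; linarith
    refine ⟨Real.arcosh (y + c), ?_, ?_⟩
    · exact Real.arcosh_pos hy'
    · simp [Real.cosh_arcosh hy'.le]

lemma bm_cosh_inj (c : ℝ) : InjOn (fun v => Real.cosh v - c) (Ioi 0) := by
  intro a ha b hb h
  have h' : Real.cosh a = Real.cosh b := by simpa using h
  exact Real.cosh_injOn (Ioi_subset_Ici_self ha) (Ioi_subset_Ici_self hb) h'

lemma bm_cosh_deriv (c : ℝ) : ∀ v ∈ Ioi (0:ℝ), HasDerivWithinAt (fun v => Real.cosh v - c) (Real.sinh v) (Ioi 0) v :=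
  fun v _ => ((Real.hasDerivAt_cosh v).sub_const c).hasDerivWithinAt

lemma bm_sinh_aux {v : ℝ} (hv : 0 < v) :
    |Real.sinh v| * ((Real.cosh v - 1) ^ (-(1/2) : ℝ) * (Real.cosh v + 1) ^ (-(1/2) : ℝ)) = 1 := by
  have h1 := Real.one_lt_cosh.2 hv.ne'
  have hs : 0 < Real.sinh v := Real.sinh_pos_iff.2 hv
  rw [← Real.mul_rpow (by linarith) (by linarith)]
  have : (Real.cosh v - 1) * (Real.cosh v + 1) = Real.sinh v ^ (2:ℝ) := by
    rw [Real.rpow_two, Real.sinh_sq]; ring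
  rw [this, ← Real.rpow_mul hs.le, abs_of_pos hs]
  norm_num [Real.rpow_neg_one, hs.ne']

lemma bm_sin_aux {a : ℝ} (h0 : 0 < a) (h1 : a < Real.pi) :
    |Real.sin a| * ((1 - Real.cos a) ^ (-(1/2) : ℝ) * (1 + Real.cos a) ^ (-(1/2) : ℝ)) = 1 := by
  have hs : 0 < Real.sin a := Real.sin_pos_of_pos_of_lt_pi h0 h1
  rw [← Real.mul_rpow (by linarith [Real.cos_le_one a]) (by linarith [Real.neg_one_le_cos a])]
  have : (1 - Real.cos a) * (1 + Real.cos a) = Real.sin a ^ (2:ℝ) := by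
    rw [Real.rpow_two, Real.sin_sq]; ring
  rw [this, ← Real.rpow_mul hs.le, abs_of_pos hs]
  norm_num [Real.rpow_neg_one, hs.ne']

lemma bm_intK (m : ℕ) (t : ℝ) : bmK m t = Real.exp (-t) * ∫ y in Ioi (0:ℝ),
    Real.exp (-(t * y)) * y ^ (-(1/2) : ℝ) * (1 + y) ^ m * (2 + y) ^ (-(1/2) : ℝ) := by
  have h := integral_image_eq_integral_abs_deriv_smul measurableSet_Ioi (bm_cosh_deriv 1)
    (bm_cosh_inj 1) (fun y => Real.exp (-(t * y)) * y ^ (-(1/2) : ℝ) * (1 + y) ^ m * (2 + y) ^ (-(1/2) : ℝ))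
  rw [bm_image_cosh, sub_self] at h
  rw [h, ← integral_const_mul, bmK]
  refine setIntegral_congr_fun measurableSet_Ioi fun v hv => ?_
  have hx := bm_sinh_aux hv
  have e2 : 2 + (Real.cosh v - 1) = Real.cosh v + 1 := by ring
  have e1 : 1 + (Real.cosh v - 1) = Real.cosh v := by ring
  have e3 : Real.exp (-(t * Real.cosh v)) = Real.exp (-t) * Real.exp (-(t * (Real.cosh v - 1))) := by
    rw [← Real.exp_add]; ring_nf
  simp only [smul_eq_mul]
  rw [e1, e2, e3]
  linear_combination (-(Real.cosh v ^ m * (Real.exp (-t) * Real.exp (-(t * (Real.cosh v - 1)))))) * hx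

lemma bm_intK_integrable {m : ℕ} (hm : m ≤ 1) {t : ℝ} (ht : 0 < t) :
    IntegrableOn (fun v => Real.cosh v ^ m * Real.exp (-(t * Real.cosh v))) (Ioi 0) := by
  have h := integrableOn_image_iff_integrableOn_abs_deriv_smul measurableSet_Ioi (bm_cosh_deriv 1)
    (bm_cosh_inj 1) (fun y => Real.exp (-(t * y)) * y ^ (-(1/2) : ℝ) * (1 + y) ^ m * (2 + y) ^ (-(1/2) : ℝ))
  rw [bm_image_cosh, sub_self] at h
  have h2 : IntegrableOn (fun y => Real.exp (-(t * y)) * y ^ (-(1/2) : ℝ) * (1 + y) ^ m *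
      (2 + y) ^ (-(1/2) : ℝ)) (Ioi 0) := by
    refine Integrable.mono' (bmg_integrable hm ht) (Measurable.aestronglyMeasurable (by fun_prop)) ?_
    refine bm_ae _ fun y hy hy2 => ?_
    rw [Real.norm_of_nonneg (by positivity)]
    unfold bmg
    refine mul_le_mul_of_nonneg_left ?_ (by positivity)
    refine Real.rpow_le_rpow_of_nonpos (abs_pos.2 (sub_ne_zero.2 hy2.symm)) ?_ (by norm_num)
    rw [abs_le]; constructor <;> linarith
  refine ((h.1 h2).const_mul (Real.exp (-t))).congr ?_
  filter_upwards [ae_restrict_mem measurableSet_Ioi] with v hv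
  have hx := bm_sinh_aux hv
  have e2 : 2 + (Real.cosh v - 1) = Real.cosh v + 1 := by ring
  have e1 : 1 + (Real.cosh v - 1) = Real.cosh v := by ring
  have e3 : Real.exp (-(t * Real.cosh v)) = Real.exp (-t) * Real.exp (-(t * (Real.cosh v - 1))) := by
    rw [← Real.exp_add]; ring_nf
  simp only [smul_eq_mul]
  rw [e1, e2, e3]
  linear_combination ((Real.cosh v ^ m * (Real.exp (-t) * Real.exp (-(t * (Real.cosh v - 1)))))) * hx

lemma bm_intK2 (m : ℕ) (t : ℝ) : (-1) ^ m * bmK m t = Real.exp t * ∫ y in Ioi (2:ℝ),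
    Real.exp (-(t * y)) * y ^ (-(1/2) : ℝ) * (1 - y) ^ m * (y - 2) ^ (-(1/2) : ℝ) := by
  have h := integral_image_eq_integral_abs_deriv_smul measurableSet_Ioi (bm_cosh_deriv (-1))
    (bm_cosh_inj (-1)) (fun y => Real.exp (-(t * y)) * y ^ (-(1/2) : ℝ) * (1 - y) ^ m * (y - 2) ^ (-(1/2) : ℝ))
  rw [bm_image_cosh, (by norm_num : (1:ℝ) - -1 = 2)] at h
  rw [h, ← integral_const_mul, bmK, ← integral_const_mul]
  refine setIntegral_congr_fun measurableSet_Ioi fun v hv => ?_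
  have hx := bm_sinh_aux hv
  have e2 : (Real.cosh v - -1) - 2 = Real.cosh v - 1 := by ring
  have e1 : 1 - (Real.cosh v - -1) = (-1) * Real.cosh v := by ring
  have e4 : Real.cosh v - -1 = Real.cosh v + 1 := by ring
  have e3 : Real.exp (-(t * Real.cosh v)) = Real.exp t * Real.exp (-(t * (Real.cosh v + 1))) := by
    rw [← Real.exp_add]; ring_nf
  simp only [smul_eq_mul]
  rw [e1, e2, e3, e4, mul_pow]
  linear_combination (-((-1) ^ m * Real.cosh v ^ m * (Real.exp t * Real.exp (-(t * (Real.cosh v + 1)))))) * hx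

lemma bm_intI (m : ℕ) (t : ℝ) : bmI m t = Real.exp t * ∫ y in Ioo (0:ℝ) 2,
    Real.exp (-(t * y)) * y ^ (-(1/2) : ℝ) * (1 - y) ^ m * (2 - y) ^ (-(1/2) : ℝ) := by
  have himg : (fun a => 1 - Real.cos a) '' Ioo 0 Real.pi = Ioo 0 2 := by
    ext y
    constructor
    · rintro ⟨a, ha, rfl⟩
      have h1 : Real.cos a < Real.cos 0 := Real.cos_lt_cos_of_nonneg_of_le_pi le_rfl ha.2.le ha.1
      have h2 : Real.cos Real.pi < Real.cos a := Real.cos_lt_cos_of_nonneg_of_le_pi ha.1.le le_rfl ha.2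
      rw [Real.cos_zero] at h1
      rw [Real.cos_pi] at h2
      exact ⟨by simpa using h1, by simp only; linarith⟩
    · intro hy
      refine ⟨Real.arccos (1 - y), ⟨Real.arccos_pos.2 (by linarith [hy.1]), ?_⟩, ?_⟩
      · refine lt_of_le_of_ne (Real.arccos_le_pi _) fun h => ?_
        rw [Real.arccos_eq_pi] at h
        linarith [hy.2]
      · simp only
        rw [Real.cos_arccos (by linarith [hy.2]) (by linarith [hy.1])]; ring
  have hinj : InjOn (fun a => 1 - Real.cos a) (Ioo 0 Real.pi) := by
    intro a ha b hb h
    exact Real.injOn_cos (Ioo_subset_Icc_self ha) (Ioo_subset_Icc_self hb) (by simpa using h)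
  have hder : ∀ a ∈ Ioo 0 Real.pi, HasDerivWithinAt (fun a => 1 - Real.cos a) (Real.sin a) (Ioo 0 Real.pi) a := by
    intro a _
    have := (Real.hasDerivAt_cos a).const_sub 1
    simpa using this.hasDerivWithinAt
  have h := integral_image_eq_integral_abs_deriv_smul measurableSet_Ioo hder hinj
    (fun y => Real.exp (-(t * y)) * y ^ (-(1/2) : ℝ) * (1 - y) ^ m * (2 - y) ^ (-(1/2) : ℝ))
  rw [himg] at h
  rw [h, ← integral_const_mul, bmI, intervalIntegral.integral_of_le Real.pi_pos.le,
    integral_Ioc_eq_integral_Ioo]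
  refine setIntegral_congr_fun measurableSet_Ioo fun a ha => ?_
  have hx := bm_sin_aux ha.1 ha.2
  have e2 : 2 - (1 - Real.cos a) = 1 + Real.cos a := by ring
  have e1 : 1 - (1 - Real.cos a) = Real.cos a := by ring
  have e3 : Real.exp (t * Real.cos a) = Real.exp t * Real.exp (-(t * (1 - Real.cos a))) := by
    rw [← Real.exp_add]; ring_nf
  simp only [smul_eq_mul]
  rw [e1, e2, e3]
  linear_combination (-(Real.cos a ^ m * (Real.exp t * Real.exp (-(t * (1 - Real.cos a)))))) * hx

lemma bmk_real (m : ℕ) (τ : ℝ) : bmk m (τ : ℂ) = (bmK m (Real.exp τ) : ℂ) := by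
  unfold bmk
  have hE : bmE (τ:ℂ) = 1 := by simp [bmE]
  rw [hE, bm_intK]
  push_cast
  rw [← integral_complex_ofReal]
  simp only [Complex.ofReal_im, Complex.ofReal_re, neg_zero, zero_div, Complex.ofReal_zero, zero_mul,
    Complex.exp_zero, mul_one]
  congr 1
  refine setIntegral_congr_fun measurableSet_Ioi fun y hy => ?_
  have hy' : (0:ℝ) < y := hy
  simp only [bmH, mul_one]
  rw [← Complex.ofReal_ofNat, ← Complex.ofReal_one, ← Complex.ofReal_add, ← Complex.ofReal_add,
    ← Complex.ofReal_cpow (by positivity)]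
  push_cast
  ring

lemma bmH_integrable {m : ℕ} (hm : m ≤ 1) {ρ : ℝ} (hρ : 0 < ρ) {E : ℂ} (hE : ‖E‖ = 1) :
    IntegrableOn (bmH m ρ E) (Ioi 0) :=
  Integrable.mono' (bmg_integrable hm hρ) (bmH_meas _ _ _).aestronglyMeasurable
    (bm_ae _ fun _ hy hy2 => bmH_norm_le m ρ hE hy hy2)

lemma bmk_neg {m : ℕ} (hm : m ≤ 1) (τ : ℝ) : bmk m (τ - Real.pi * Complex.I) =
    (-1) ^ m * (bmK m (Real.exp τ) : ℂ) + Complex.I * (bmI m (Real.exp τ) : ℂ) := by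
  have him : ((τ:ℂ) - Real.pi * Complex.I).im = -Real.pi := by simp
  have hre : ((τ:ℂ) - Real.pi * Complex.I).re = τ := by simp
  have hE : bmE (τ - Real.pi * Complex.I) = -1 := by
    unfold bmE; rw [him, neg_neg, Complex.exp_pi_mul_I]
  have hintg := bmH_integrable hm (Real.exp_pos τ) (E := -1) (by simp)
  have hexp : Complex.exp (τ - Real.pi * Complex.I) = -(Real.exp τ : ℂ) := by
    rw [Complex.exp_sub, Complex.exp_pi_mul_I, Complex.ofReal_exp, div_neg, div_one]
  have hI : Complex.exp ((- -Real.pi / 2 : ℝ) * Complex.I) = Complex.I := by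
    rw [neg_neg]; push_cast; exact Complex.exp_pi_div_two_mul_I
  unfold bmk
  rw [hE, hexp, him, hre, hI, neg_neg]
  set t := Real.exp τ with ht
  rw [← Ioc_union_Ioi_eq_Ioi (zero_le_two : (0:ℝ) ≤ 2)] at hintg ⊢
  rw [setIntegral_union (Ioc_disjoint_Ioi le_rfl) measurableSet_Ioi
    (hintg.mono_set subset_union_left) (hintg.mono_set subset_union_right),
    integral_Ioc_eq_integral_Ioo]
  have c1 : ((-1) ^ m * (bmK m t : ℂ)) = (((-1) ^ m * bmK m t : ℝ) : ℂ) := by push_cast; ring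
  rw [c1, bm_intK2, bm_intI]
  push_cast
  rw [← integral_complex_ofReal, ← integral_complex_ofReal]
  have p1 : ∫ y in Ioo (0:ℝ) 2, bmH m t (-1) y = ∫ y in Ioo (0:ℝ) 2,
      ((Real.exp (-(t * y)) * y ^ (-(1/2) : ℝ) * (1 - y) ^ m * (2 - y) ^ (-(1/2) : ℝ) : ℝ) : ℂ) := by
    refine setIntegral_congr_fun measurableSet_Ioo fun y hy => ?_
    simp only [bmH]
    have e : (2 + (y:ℂ) * -1) = ((2 - y : ℝ) : ℂ) := by push_cast; ring
    rw [e, ← Complex.ofReal_cpow (by linarith [hy.2])]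
    push_cast
    ring
  have p2 : ∫ y in Ioi (2:ℝ), bmH m t (-1) y = -Complex.I * ∫ y in Ioi (2:ℝ),
      ((Real.exp (-(t * y)) * y ^ (-(1/2) : ℝ) * (1 - y) ^ m * (y - 2) ^ (-(1/2) : ℝ) : ℝ) : ℂ) := by
    rw [← integral_const_mul]
    refine setIntegral_congr_fun measurableSet_Ioi fun y hy => ?_
    have hy' : (2:ℝ) < y := hy
    simp only [bmH]
    have e : (2 + (y:ℂ) * -1) = ((2 - y : ℝ) : ℂ) := by push_cast; ring
    rw [e, Complex.ofReal_cpow_of_nonpos (by linarith)]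
    have e2 : -((2 - y : ℝ) : ℂ) = ((y - 2 : ℝ) : ℂ) := by push_cast; ring
    have e3 : Complex.exp (Real.pi * Complex.I * ((-(1/2) : ℝ) : ℂ)) = -Complex.I := by
      have : (Real.pi * Complex.I * ((-(1/2) : ℝ) : ℂ)) = -Real.pi / 2 * Complex.I := by push_cast; ring
      rw [this, Complex.exp_neg_pi_div_two_mul_I]
    rw [e2, e3, ← Complex.ofReal_cpow (by linarith)]
    push_cast
    ring
  rw [p1, p2]
  push_cast
  linear_combination (-(Complex.exp t * ∫ y in Ioi (2:ℝ),
      (Complex.exp (-(t * y)) * (((y ^ (-(1/2) : ℝ) : ℝ)) : ℂ) * (1 - y) ^ m * (((y - 2) ^ (-(1/2) : ℝ) : ℝ) : ℂ)))) * Complex.I_sq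

lemma besselK0_eq (t : ℝ) : besselK0 t = bmK 0 t := by simp [besselK0, bmK]

lemma besselI0_eq (t : ℝ) : Real.pi * besselI0 t = bmI 0 t := by
  simp only [besselI0, bmI, pow_zero, one_mul]
  field_simp

lemma besselI1_eq (t : ℝ) : Real.pi * besselI1 t = bmI 1 t := by
  have h := intervalIntegral.hasDerivAt_integral_of_dominated_loc_of_deriv_le (μ := volume)
    (a := 0) (b := Real.pi) (F := fun t a => Real.exp (t * Real.cos a))
    (F' := fun t a => Real.cos a ^ 1 * Real.exp (t * Real.cos a)) (x₀ := t) (s := Metric.ball t 1)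
    (bound := fun _ => Real.exp (|t| + 1))
    (Metric.ball_mem_nhds _ one_pos)
    (Eventually.of_forall fun z => (Continuous.aestronglyMeasurable (by fun_prop)))
    (Continuous.intervalIntegrable (by fun_prop) _ _)
    (Continuous.aestronglyMeasurable (by fun_prop)) ?_ (by simp) ?_
  · have h2 : HasDerivAt besselI0 ((1 / Real.pi) * bmI 1 t) t := h.2.const_mul (1 / Real.pi)
    rw [besselI1, h2.deriv]
    field_simp
  · refine Eventually.of_forall fun a _ x hx => ?_
    rw [Metric.mem_ball, Real.dist_eq] at hx
    rw [pow_one, norm_mul, Real.norm_eq_abs, Real.norm_eq_abs, Real.abs_exp]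
    have hc := Real.abs_cos_le_one a
    have h3 : x * Real.cos a ≤ |t| + 1 := by
      calc x * Real.cos a ≤ |x * Real.cos a| := le_abs_self _
        _ = |x| * |Real.cos a| := abs_mul _ _
        _ ≤ |x| * 1 := by gcongr
        _ ≤ |t| + 1 := by
          have := abs_sub_abs_le_abs_sub x t
          linarith
    calc _ ≤ 1 * Real.exp (|t| + 1) := by gcongr
      _ = _ := one_mul _
  · refine Eventually.of_forall fun a _ x hx => ?_
    have := ((hasDerivAt_id x).mul_const (Real.cos a)).exp
    simpa [mul_comm] using this

lemma besselK1_eq {t : ℝ} (ht : 0 < t) : besselK1 t = bmK 1 t := by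
  have h := hasDerivAt_integral_of_dominated_loc_of_deriv_le (μ := volume.restrict (Ioi (0:ℝ)))
    (F := fun t v => Real.exp (-(t * Real.cosh v)))
    (F' := fun t v => -(Real.cosh v ^ 1 * Real.exp (-(t * Real.cosh v)))) (x₀ := t)
    (s := Metric.ball t (t / 2))
    (bound := fun v => Real.cosh v ^ 1 * Real.exp (-(t / 2 * Real.cosh v)))
    (Metric.ball_mem_nhds _ (by positivity))
    (Eventually.of_forall fun z => (Continuous.aestronglyMeasurable (by fun_prop)))
    (by simpa [IntegrableOn] using bm_intK_integrable (m := 0) (by norm_num) ht)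
    (Continuous.aestronglyMeasurable (by fun_prop)) ?_
    (bm_intK_integrable le_rfl (by positivity)) ?_
  · have h2 : HasDerivAt besselK0 (-bmK 1 t) t := by
      have := h.2
      rw [integral_neg] at this
      exact this
    rw [besselK1, h2.deriv, neg_neg]
  · refine Eventually.of_forall fun a x hx => ?_
    rw [Metric.mem_ball, Real.dist_eq] at hx
    have := Real.cosh_pos a
    rw [norm_neg, Real.norm_of_nonneg (by positivity)]
    have h3 : t / 2 ≤ x := by linarith [(abs_lt.1 hx).1]
    gcongr
  · refine Eventually.of_forall fun a x hx => ?_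
    have := ((hasDerivAt_id x).mul_const (Real.cosh a)).neg.exp
    simpa [mul_comm] using this


lemma bm_exp_abs_integrable : Integrable (fun τ : ℝ => Real.exp (-|τ| / 4)) := by
  rw [← integrableOn_univ, ← Iic_union_Ioi (a := (0:ℝ))]
  refine IntegrableOn.union ?_ ?_
  · refine (integrableOn_exp_mul_Iic (a := 1 / 4) (by norm_num) 0).congr_fun (fun x hx => ?_) measurableSet_Iic
    simp only [abs_of_nonpos (mem_Iic.1 hx)]
    ring_nf
  · refine (integrableOn_exp_mul_Ioi (a := -1 / 4) (by norm_num) 0).congr_fun (fun x hx => ?_) measurableSet_Ioi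
    simp only [abs_of_pos (mem_Ioi.1 hx)]
    ring_nf

lemma bm_line_integrable {G : ℂ → ℂ} (hc : ContinuousOn G bmS) {C : ℝ}
    (hb : ∀ w ∈ bmS, ‖G w‖ ≤ C * Real.exp (-|w.re| / 4)) {y : ℝ} (h1 : -Real.pi ≤ y) (h2 : y ≤ 0) :
    Integrable (fun x : ℝ => G (x + y * Complex.I)) := by
  have hmem : ∀ x : ℝ, (x + y * Complex.I : ℂ) ∈ bmS := fun x => by
    simp [bmS, h1, h2]
  have hcont : Continuous (fun x : ℝ => G (x + y * Complex.I)) :=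
    hc.comp_continuous (by fun_prop) hmem
  refine Integrable.mono' (bm_exp_abs_integrable.const_mul C) hcont.aestronglyMeasurable
    (Eventually.of_forall fun x => ?_)
  simpa using hb _ (hmem x)

lemma bm_cauchy {G : ℂ → ℂ} (hc : ContinuousOn G bmS)
    (hd : ∀ w : ℂ, -Real.pi < w.im → w.im < 0 → DifferentiableAt ℂ G w) {C : ℝ}
    (hb : ∀ w ∈ bmS, ‖G w‖ ≤ C * Real.exp (-|w.re| / 4)) :
    ∫ x : ℝ, G (x + (-Real.pi : ℝ) * Complex.I) = ∫ x : ℝ, G (x + (0:ℝ) * Complex.I) := by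
  have hπ := Real.pi_pos
  have i1 := bm_line_integrable hc hb (y := -Real.pi) le_rfl (by linarith)
  have i2 := bm_line_integrable hc hb (y := 0) (by linarith) le_rfl
  have t1 := intervalIntegral_tendsto_integral i1 tendsto_neg_atTop_atBot tendsto_id
  have t2 := intervalIntegral_tendsto_integral i2 tendsto_neg_atTop_atBot tendsto_id
  have hexp : Tendsto (fun T : ℝ => C * Real.exp (-T / 4) * |0 - -Real.pi|) atTop (𝓝 0) := by
    have h0 : Tendsto (fun T : ℝ => Real.exp (-T / 4)) atTop (𝓝 0) := by
      refine Real.tendsto_exp_atBot.comp ?_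
      exact tendsto_neg_atTop_atBot.atBot_div_const (by norm_num)
    simpa using (h0.const_mul C).mul_const (|0 - -Real.pi|)
  have vert : ∀ σ : ℝ, |σ| = 1 → Tendsto (fun T : ℝ => ∫ y in (-Real.pi)..0, G ((σ * T : ℝ) + y * Complex.I))
      atTop (𝓝 0) := by
    intro σ hσ
    refine squeeze_zero_norm' ?_ hexp
    filter_upwards [eventually_ge_atTop 0] with T hT
    refine intervalIntegral.norm_integral_le_of_norm_le_const fun y hy => ?_
    rw [uIoc_of_le (by linarith)] at hy
    have hm : (((σ * T : ℝ) : ℂ) + y * Complex.I) ∈ bmS := by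
      simp only [bmS, mem_ofPred_eq, Complex.add_im, Complex.ofReal_im, Complex.mul_im, Complex.ofReal_re,
        Complex.I_im, Complex.I_re]
      constructor <;> linarith [hy.1, hy.2]
    have := hb _ hm
    have hre : ((((σ * T : ℝ) : ℂ) + y * Complex.I)).re = σ * T := by simp
    rw [hre, abs_mul, hσ, one_mul, abs_of_nonneg hT] at this
    exact this
  have v1 := vert 1 (by simp)
  have v2 := vert (-1) (by simp)
  have hrect : ∀ᶠ T : ℝ in atTop, (∫ x in (-T)..T, G (x + (-Real.pi : ℝ) * Complex.I)) -
      (∫ x in (-T)..T, G (x + (0:ℝ) * Complex.I)) +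
      Complex.I • (∫ y in (-Real.pi)..0, G ((1 * T : ℝ) + y * Complex.I)) -
      Complex.I • (∫ y in (-Real.pi)..0, G ((-1 * T : ℝ) + y * Complex.I)) = 0 := by
    filter_upwards [eventually_ge_atTop 0] with T hT
    have := Complex.integral_boundary_rect_eq_zero_of_continuousOn_of_differentiableOn G
      ⟨-T, -Real.pi⟩ ⟨T, 0⟩ (hc.mono ?_) ?_
    · simpa using this
    · intro w hw
      rw [Complex.mem_reProdIm] at hw
      have h2 := hw.2
      simp only [uIcc_of_le (by linarith : -Real.pi ≤ 0)] at h2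
      exact h2
    · intro w hw
      rw [Complex.mem_reProdIm] at hw
      have h2 := hw.2
      simp only [min_eq_left (by linarith : -Real.pi ≤ 0), max_eq_right (by linarith : -Real.pi ≤ 0)] at h2
      exact (hd w h2.1 h2.2).differentiableWithinAt
  have lim := (((t1.sub t2).add (v1.const_smul Complex.I)).sub (v2.const_smul Complex.I))
  have lim0 := lim.congr' (hrect.mono fun T hT => hT)
  have := tendsto_nhds_unique lim0 tendsto_const_nhds
  simp only [smul_zero, add_zero, sub_zero] at this
  exact sub_eq_zero.1 this

lemma bm_bound_aux {m : ℕ} (hm : m ≤ 1) (k l : ℕ) {c : ℝ} (hc : 0 < c) {δ : ℝ} (h0 : 0 < δ)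
    (h1 : δ < 1 / 2) : ∃ C : ℝ, 0 ≤ C ∧ ∀ τ : ℝ,
      Real.exp τ ^ (2 * l) * (Real.exp τ ^ m * bmN m (c * Real.exp τ)) * bmN 0 (Real.exp τ) ^ (2 * k) ≤
        C * ((c * Real.exp τ + 2) ^ m * Real.exp (τ * (2 * l - (2 * k + 1) * δ))) := by
  obtain ⟨C1, hC1, H1⟩ := bmN_le hm h0 h1
  obtain ⟨C2, hC2, H2⟩ := bmN_le (m := 0) (by norm_num) h0 h1
  refine ⟨(c ^ m)⁻¹ * (C1 * c ^ (-δ)) * C2 ^ (2 * k), by positivity, fun τ => ?_⟩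
  set ρ := Real.exp τ with hρ
  have hρ0 : 0 < ρ := Real.exp_pos _
  have a1 := H1 (c * ρ) (by positivity)
  have a2 := H2 ρ hρ0
  simp only [pow_zero, one_mul] at a2
  have n1 := bmN_nonneg m (c * ρ)
  have n2 := bmN_nonneg 0 ρ
  have b1 : ρ ^ m * bmN m (c * ρ) ≤ (c ^ m)⁻¹ * (C1 * ((c * ρ + 2) ^ m * (c * ρ) ^ (-δ))) := by
    rw [← div_eq_inv_mul, le_div_iff₀ (by positivity)]
    calc _ = (c * ρ) ^ m * bmN m (c * ρ) := by rw [mul_pow]; ring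
      _ ≤ _ := a1
  have b2 : bmN 0 ρ ^ (2 * k) ≤ (C2 * ρ ^ (-δ)) ^ (2 * k) := by gcongr
  have e1 : ρ ^ (-δ) = Real.exp (τ * (-δ)) := by rw [hρ, ← Real.exp_mul]
  calc _ ≤ ρ ^ (2 * l) * ((c ^ m)⁻¹ * (C1 * ((c * ρ + 2) ^ m * (c * ρ) ^ (-δ)))) * (C2 * ρ ^ (-δ)) ^ (2 * k) := by
        gcongr
    _ = (c ^ m)⁻¹ * (C1 * c ^ (-δ)) * C2 ^ (2 * k) * ((c * ρ + 2) ^ m *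
        (ρ ^ (2 * l) * (ρ ^ (-δ) * (ρ ^ (-δ)) ^ (2 * k)))) := by
        rw [Real.mul_rpow hc.le hρ0.le, mul_pow]; ring
    _ = _ := by
        congr 2
        rw [e1, hρ, ← Real.exp_nat_mul, ← Real.exp_nat_mul, ← Real.exp_add, ← Real.exp_add]
        congr 1
        push_cast
        ring

lemma bm_bound {m : ℕ} (hm : m ≤ 1) {k l : ℕ} (hk : 2 ≤ k) (hl : 1 ≤ l) (hlk : 2 * l + m ≤ k)
    {c : ℝ} (hc : 0 < c) : ∃ C : ℝ, 0 ≤ C ∧ ∀ τ : ℝ,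
      Real.exp τ ^ (2 * l) * (Real.exp τ ^ m * bmN m (c * Real.exp τ)) * bmN 0 (Real.exp τ) ^ (2 * k) ≤
        C * Real.exp (-|τ| / 4) := by
  have hk' : (2:ℝ) ≤ k := by exact_mod_cast hk
  have hl' : (1:ℝ) ≤ l := by exact_mod_cast hl
  have hlk' : 2 * (l:ℝ) + m ≤ k := by exact_mod_cast hlk
  obtain ⟨C1, hC1, H1⟩ := bm_bound_aux hm k l hc (δ := 1 / (2 * k + 1)) (by positivity)
    (by rw [div_lt_div_iff₀ (by positivity) (by norm_num)]; linarith)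
  obtain ⟨C2, hC2, H2⟩ := bm_bound_aux hm k l hc (δ := (k + 1/4) / (2 * k + 1)) (by positivity)
    (by rw [div_lt_div_iff₀ (by positivity) (by norm_num)]; linarith)
  refine ⟨(C1 + C2) * (c + 2) ^ m, by positivity, fun τ => ?_⟩
  rcases le_total τ 0 with h | h
  · refine (H1 τ).trans ?_
    have e1 : Real.exp τ ≤ 1 := Real.exp_le_one_iff.2 h
    have e2 : (c * Real.exp τ + 2) ^ m ≤ (c + 2) ^ m := by
      gcongr; nlinarith
    have e3 : Real.exp (τ * (2 * l - (2 * k + 1) * (1 / (2 * k + 1)))) ≤ Real.exp (-|τ| / 4) := by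
      rw [abs_of_nonpos h, Real.exp_le_exp, mul_one_div_cancel (by positivity)]
      nlinarith
    calc _ ≤ C1 * ((c + 2) ^ m * Real.exp (-|τ| / 4)) := by gcongr
      _ ≤ (C1 + C2) * ((c + 2) ^ m * Real.exp (-|τ| / 4)) := by gcongr; linarith
      _ = _ := by ring
  · refine (H2 τ).trans ?_
    have e1 : 1 ≤ Real.exp τ := Real.one_le_exp h
    have e2 : (c * Real.exp τ + 2) ^ m ≤ ((c + 2) * Real.exp τ) ^ m := by
      gcongr; nlinarith
    have e3 : Real.exp τ ^ m * Real.exp (τ * (2 * l - (2 * k + 1) * ((k + 1/4) / (2 * k + 1)))) ≤ Real.exp (-|τ| / 4) := by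
      rw [abs_of_nonneg h, mul_div_cancel₀ _ (by positivity), ← Real.exp_nat_mul, ← Real.exp_add,
        Real.exp_le_exp]
      nlinarith
    calc _ ≤ C2 * (((c + 2) * Real.exp τ) ^ m * Real.exp (τ * (2 * l - (2 * k + 1) * ((k + 1/4) / (2 * k + 1))))) := by gcongr
      _ = C2 * ((c + 2) ^ m * (Real.exp τ ^ m * Real.exp (τ * (2 * l - (2 * k + 1) * ((k + 1/4) / (2 * k + 1)))))) := by
        rw [mul_pow]; ring
      _ ≤ C2 * ((c + 2) ^ m * Real.exp (-|τ| / 4)) := by gcongr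
      _ ≤ (C1 + C2) * ((c + 2) ^ m * Real.exp (-|τ| / 4)) := by gcongr; linarith
      _ = _ := by ring

/-- The integrand in the strip. -/
noncomputable def bmG (m k s l : ℕ) (w : ℂ) : ℂ :=
  Complex.exp (2 * l * w) * ((-1) ^ m * Complex.exp (m * w) * bmk m (w + (Real.log (2 * s) : ℝ))) *
    bmk 0 w ^ (k - s) * (starRingEnd ℂ (bmk 0 (starRingEnd ℂ (w + Real.pi * Complex.I)))) ^ (k + s)

lemma bm_conj_mem {w : ℂ} (hw : w ∈ bmS) : starRingEnd ℂ (w + Real.pi * Complex.I) ∈ bmS := by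
  simp only [bmS, mem_ofPred_eq, Complex.conj_im, Complex.add_im, Complex.mul_im, Complex.ofReal_re,
    Complex.ofReal_im, Complex.I_im, Complex.I_re]
  constructor <;> linarith [hw.1, hw.2]

lemma bmG_cont {m : ℕ} (hm : m ≤ 1) (k s l : ℕ) : ContinuousOn (bmG m k s l) bmS := by
  have h0 := bmk_continuousOn (m := 0) (by norm_num)
  have h1 : ContinuousOn (fun w : ℂ => bmk m (w + (Real.log (2 * s) : ℝ))) bmS := by
    refine (bmk_continuousOn hm).comp (by fun_prop) fun w hw => ?_
    simpa [bmS] using hw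
  have h2 : ContinuousOn (fun w : ℂ => starRingEnd ℂ (bmk 0 (starRingEnd ℂ (w + Real.pi * Complex.I)))) bmS := by
    refine Complex.continuous_conj.comp_continuousOn (h0.comp ?_ fun w hw => bm_conj_mem hw)
    exact (Complex.continuous_conj.comp (by fun_prop)).continuousOn
  unfold bmG
  have h3 : ContinuousOn (fun w : ℂ => Complex.exp (2 * l * w)) bmS := by fun_prop
  have h4 : ContinuousOn (fun w : ℂ => (-1) ^ m * Complex.exp (m * w)) bmS := by fun_prop
  exact ((h3.mul (h4.mul h1)).mul (h0.pow _)).mul (h2.pow _)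

lemma bmG_diff {m : ℕ} (hm : m ≤ 1) (k s l : ℕ) (w : ℂ) (hw1 : -Real.pi < w.im) (hw2 : w.im < 0) :
    DifferentiableAt ℂ (bmG m k s l) w := by
  have h0 := bmk_differentiableAt (m := 0) (by norm_num) hw1 hw2
  have h1 : DifferentiableAt ℂ (fun w : ℂ => bmk m (w + (Real.log (2 * s) : ℝ))) w := by
    refine DifferentiableAt.comp w (g := bmk m) (bmk_differentiableAt hm ?_ ?_) (by fun_prop)
    · simpa using hw1
    · simpa using hw2
  have h2 : DifferentiableAt ℂ (fun w : ℂ => starRingEnd ℂ (bmk 0 (starRingEnd ℂ (w + Real.pi * Complex.I)))) w := by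
    refine DifferentiableAt.comp w (g := fun v => starRingEnd ℂ (bmk 0 (starRingEnd ℂ v))) ?_ (by fun_prop)
    have := bmk_differentiableAt (m := 0) (w := starRingEnd ℂ (w + Real.pi * Complex.I)) (by norm_num)
      (by simp; linarith) (by simp; linarith)
    have := this.conj_conj
    rw [Complex.conj_conj] at this
    exact this
  unfold bmG
  have h3 : DifferentiableAt ℂ (fun w : ℂ => Complex.exp (2 * l * w)) w := by fun_prop
  have h4 : DifferentiableAt ℂ (fun w : ℂ => (-1) ^ m * Complex.exp (m * w)) w := by fun_prop
  exact ((h3.mul (h4.mul h1)).mul (h0.pow _)).mul (h2.pow _)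

lemma bmG_norm {m : ℕ} (hm : m ≤ 1) {k s : ℕ} (hs : 1 ≤ s) (hsk : s ≤ k) (l : ℕ) (w : ℂ) :
    ‖bmG m k s l w‖ ≤ Real.exp w.re ^ (2 * l) * (Real.exp w.re ^ m * bmN m (2 * s * Real.exp w.re)) *
      bmN 0 (Real.exp w.re) ^ (2 * k) := by
  have hs0 : (0:ℝ) < 2 * s := by positivity
  have a1 := bmk_norm_le hm (w + (Real.log (2 * s) : ℝ))
  have a2 := bmk_norm_le (m := 0) (by norm_num) w
  have a3 := bmk_norm_le (m := 0) (by norm_num) (starRingEnd ℂ (w + Real.pi * Complex.I))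
  have r1 : Real.exp (w + (Real.log (2 * s) : ℝ)).re = 2 * s * Real.exp w.re := by
    rw [Complex.add_re, Complex.ofReal_re, Real.exp_add, Real.exp_log hs0, mul_comm]
  have r2 : (w + (Real.log (2 * s) : ℝ)).im = w.im := by simp
  have r3 : (starRingEnd ℂ (w + Real.pi * Complex.I)).re = w.re := by simp
  have r4 : Real.cos (starRingEnd ℂ (w + Real.pi * Complex.I)).im = -Real.cos w.im := by
    rw [Complex.conj_im, Real.cos_neg]; simp
  rw [r1, r2] at a1
  rw [r3, r4] at a3
  unfold bmG
  rw [norm_mul, norm_mul, norm_mul, norm_mul, norm_mul, norm_pow, norm_pow, norm_pow, norm_neg, norm_one,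
    one_pow, one_mul, RCLike.norm_conj, Complex.norm_exp, Complex.norm_exp]
  have x1 : Real.exp (2 * l * w).re = Real.exp w.re ^ (2 * l) := by
    rw [← Real.exp_nat_mul]; congr 1
    have : (2 * l * w : ℂ) = ((2 * l : ℝ) : ℂ) * w := by push_cast; ring
    rw [this, Complex.re_ofReal_mul]; push_cast; ring
  have x2 : Real.exp (m * w).re = Real.exp w.re ^ m := by
    rw [← Real.exp_nat_mul]; congr 1
    have : (m * w : ℂ) = ((m : ℝ) : ℂ) * w := by push_cast; ring
    rw [this, Complex.re_ofReal_mul]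
  rw [x1, x2]
  set ρ := Real.exp w.re with hρ
  have hρ0 : 0 < ρ := Real.exp_pos _
  have n1 := bmN_nonneg m (2 * s * ρ)
  have n2 := bmN_nonneg 0 ρ
  set q := Real.cos w.im
  calc _ ≤ ρ ^ (2 * l) * (ρ ^ m * (Real.exp (-(2 * s * ρ * q)) * bmN m (2 * s * ρ))) *
        (Real.exp (-(ρ * q)) * bmN 0 ρ) ^ (k - s) * (Real.exp (-(ρ * -q)) * bmN 0 ρ) ^ (k + s) := by
        gcongr
    _ = ρ ^ (2 * l) * (ρ ^ m * bmN m (2 * s * ρ)) * (bmN 0 ρ ^ (k - s) * bmN 0 ρ ^ (k + s)) *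
        (Real.exp (-(2 * s * ρ * q)) * Real.exp (-(ρ * q)) ^ (k - s) * Real.exp (-(ρ * -q)) ^ (k + s)) := by
        rw [mul_pow, mul_pow]; ring
    _ = _ := by
        have e1 : k - s + (k + s) = 2 * k := by omega
        clear_value ρ
        rw [← pow_add, e1, ← Real.exp_nat_mul, ← Real.exp_nat_mul, ← Real.exp_add, ← Real.exp_add]
        have : -(2 * s * ρ * q) + ((k - s : ℕ) : ℝ) * (-(ρ * q)) + ((k + s : ℕ) : ℝ) * (-(ρ * -q)) = 0 := by
          push_cast [Nat.cast_sub hsk]; ring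
        rw [this, Real.exp_zero, mul_one]

lemma bmG_top (m k l : ℕ) {s : ℕ} (hs : 1 ≤ s) (τ : ℝ) : bmG m k s l (τ + (0:ℝ) * Complex.I) =
    (Real.exp τ : ℂ) ^ (2 * l) * ((-1) ^ m * (Real.exp τ : ℂ) ^ m * bmK m (2 * s * Real.exp τ)) *
      (bmK 0 (Real.exp τ) : ℂ) ^ (k - s) *
      (bmK 0 (Real.exp τ) - Complex.I * bmI 0 (Real.exp τ)) ^ (k + s) := by
  have hs0 : (0:ℝ) < 2 * s := by positivity
  unfold bmG
  rw [Complex.ofReal_zero, zero_mul, add_zero, ← Complex.ofReal_add, bmk_real, bmk_real]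
  have e1 : starRingEnd ℂ (τ + Real.pi * Complex.I) = τ - Real.pi * Complex.I := by
    simp [sub_eq_add_neg]
  rw [e1, bmk_neg (by norm_num), Real.exp_add, Real.exp_log hs0, mul_comm (Real.exp τ) (2 * s : ℝ)]
  simp only [pow_zero, one_mul, map_add, map_mul, Complex.conj_ofReal, Complex.conj_I]
  rw [Complex.ofReal_exp, ← Complex.exp_nat_mul, ← Complex.exp_nat_mul]
  push_cast
  ring

lemma bmG_bot {m : ℕ} (hm : m ≤ 1) (k l : ℕ) {s : ℕ} (hs : 1 ≤ s) (τ : ℝ) :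
    bmG m k s l (τ + (-Real.pi : ℝ) * Complex.I) =
    (Real.exp τ : ℂ) ^ (2 * l) * ((-1) ^ m * (Real.exp τ : ℂ) ^ m * bmK m (2 * s * Real.exp τ) +
      Complex.I * ((Real.exp τ : ℂ) ^ m * bmI m (2 * s * Real.exp τ))) *
      (bmK 0 (Real.exp τ) + Complex.I * bmI 0 (Real.exp τ)) ^ (k - s) *
      (bmK 0 (Real.exp τ) : ℂ) ^ (k + s) := by
  have hs0 : (0:ℝ) < 2 * s := by positivity
  have e0 : (τ + (-Real.pi : ℝ) * Complex.I : ℂ) = τ - Real.pi * Complex.I := by push_cast; ring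
  have e1 : starRingEnd ℂ (τ - Real.pi * Complex.I + Real.pi * Complex.I) = τ := by simp
  have e2 : (τ - Real.pi * Complex.I + (Real.log (2 * s) : ℝ) : ℂ) =
    ((τ + Real.log (2 * s) : ℝ) : ℂ) - Real.pi * Complex.I := by push_cast; ring
  have e3 : Complex.exp (τ - Real.pi * Complex.I) = -(Real.exp τ : ℂ) := by
    rw [Complex.exp_sub, Complex.exp_pi_mul_I, Complex.ofReal_exp, div_neg, div_one]
  unfold bmG
  rw [e0, e1, e2, bmk_neg hm, bmk_neg (by norm_num), bmk_real, Real.exp_add, Real.exp_log hs0,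
    mul_comm (Real.exp τ) (2 * s : ℝ)]
  have e4 : Complex.exp (2 * l * (τ - Real.pi * Complex.I)) = (Real.exp τ : ℂ) ^ (2 * l) := by
    have : (2 * l * (τ - Real.pi * Complex.I) : ℂ) = ((2 * l : ℕ) : ℂ) * (τ - Real.pi * Complex.I) := by
      push_cast; ring
    rw [this, Complex.exp_nat_mul, e3, Even.neg_pow (even_two_mul l)]
  rw [e4, Complex.exp_nat_mul, e3, Complex.conj_ofReal, neg_pow (Real.exp τ : ℂ) m]
  simp only [pow_zero, one_mul]
  have e5 : ((-1 : ℂ)) ^ m * (-1) ^ m = 1 := by rw [← mul_pow]; simp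
  linear_combination ((Real.exp τ : ℂ) ^ (2 * l) * (bmK 0 (Real.exp τ) + Complex.I * bmI 0 (Real.exp τ)) ^ (k - s) *
      (bmK 0 (Real.exp τ) : ℂ) ^ (k + s) * ((Real.exp τ : ℂ) ^ m * ((-1) ^ m * (bmK m (2 * s * Real.exp τ) : ℂ) +
        Complex.I * bmI m (2 * s * Real.exp τ)))) * e5


lemma bm_cov (f : ℝ → ℝ) : ∫ t in Ioi (0:ℝ), f t = ∫ τ : ℝ, Real.exp τ * f (Real.exp τ) := by
  have h := integral_image_eq_integral_abs_deriv_smul (s := univ) (f := Real.exp) (f' := Real.exp)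
    MeasurableSet.univ (fun x _ => (Real.hasDerivAt_exp x).hasDerivWithinAt) Real.exp_injective.injOn f
  rw [image_univ, Real.range_exp] at h
  rw [h, Measure.restrict_univ]
  simp [abs_of_pos (Real.exp_pos _)]

/-- The `K`-factor. -/
noncomputable def bmX (m s : ℕ) (τ : ℝ) : ℝ := (-1) ^ m * Real.exp τ ^ m * bmK m (2 * s * Real.exp τ)

/-- The `I`-factor. -/
noncomputable def bmY (m s : ℕ) (τ : ℝ) : ℝ := Real.exp τ ^ m * bmI m (2 * s * Real.exp τ)

/-- Generic moment integrand. -/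
noncomputable def bmT (l : ℕ) (Z : ℝ → ℝ) (p q : ℕ) (τ : ℝ) : ℝ :=
  Real.exp τ ^ (2 * l) * Z τ * bmI 0 (Real.exp τ) ^ p * bmK 0 (Real.exp τ) ^ q

lemma bmK_cont {m : ℕ} (hm : m ≤ 1) : Continuous (fun τ : ℝ => bmK m (Real.exp τ)) := by
  have hπ := Real.pi_pos
  have h : Continuous (fun τ : ℝ => bmk m (τ : ℂ)) :=
    (bmk_continuousOn hm).comp_continuous (by fun_prop) (fun τ => by simp [bmS, hπ.le])
  have h2 := Complex.continuous_re.comp h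
  refine h2.congr fun τ => ?_
  simp [bmk_real]

lemma bmI_cont {m : ℕ} (hm : m ≤ 1) : Continuous (fun τ : ℝ => bmI m (Real.exp τ)) := by
  have hπ := Real.pi_pos
  have h : Continuous (fun τ : ℝ => bmk m (τ - Real.pi * Complex.I)) :=
    (bmk_continuousOn hm).comp_continuous (by fun_prop) (fun τ => by simp [bmS, hπ.le])
  have h2 := Complex.continuous_im.comp h
  refine h2.congr fun τ => ?_
  have e : ((-1 : ℂ) ^ m) = (((-1 : ℝ) ^ m : ℝ) : ℂ) := by push_cast; rfl
  simp only [Function.comp, bmk_neg hm, e, ← Complex.ofReal_mul, Complex.add_im, Complex.ofReal_im, Complex.I_mul_im,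
    Complex.ofReal_re, zero_add]

lemma bmK_le {m : ℕ} (hm : m ≤ 1) (τ : ℝ) :
    |bmK m (Real.exp τ)| ≤ Real.exp (-Real.exp τ) * bmN m (Real.exp τ) := by
  have h := bmk_norm_le hm (τ : ℂ)
  rw [bmk_real, Complex.norm_real] at h
  simpa using h

lemma bmI_le {m : ℕ} (hm : m ≤ 1) (τ : ℝ) :
    |bmI m (Real.exp τ)| ≤ Real.exp (Real.exp τ) * bmN m (Real.exp τ) := by
  have h := bmk_norm_le hm (τ - Real.pi * Complex.I)
  rw [bmk_neg hm] at h
  have h2 := Complex.abs_im_le_norm ((-1) ^ m * bmK m (Real.exp τ) + Complex.I * bmI m (Real.exp τ))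
  have e : ((-1 : ℂ) ^ m) = (((-1 : ℝ) ^ m : ℝ) : ℂ) := by push_cast; rfl
  have h3 : (((-1) ^ m * bmK m (Real.exp τ) + Complex.I * bmI m (Real.exp τ) : ℂ)).im = bmI m (Real.exp τ) := by
    simp only [e, ← Complex.ofReal_mul, Complex.add_im, Complex.ofReal_im, Complex.I_mul_im,
      Complex.ofReal_re, zero_add]
  rw [h3] at h2
  have h4 := h2.trans h
  simpa using h4

lemma bm_shift {s : ℕ} (hs : 1 ≤ s) (τ : ℝ) : Real.exp (τ + Real.log (2 * s)) = 2 * s * Real.exp τ := by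
  have hs0 : (0:ℝ) < 2 * s := by positivity
  rw [Real.exp_add, Real.exp_log hs0, mul_comm]

lemma bmX_cont {m s : ℕ} (hm : m ≤ 1) (hs : 1 ≤ s) : Continuous (bmX m s) := by
  unfold bmX
  have h : Continuous fun τ : ℝ => bmK m (2 * s * Real.exp τ) := by
    refine ((bmK_cont hm).comp (continuous_id.add_const (Real.log (2 * s)))).congr fun τ => ?_
    simp [bm_shift hs]
  fun_prop

lemma bmY_cont {m s : ℕ} (hm : m ≤ 1) (hs : 1 ≤ s) : Continuous (bmY m s) := by
  unfold bmY
  have h : Continuous fun τ : ℝ => bmI m (2 * s * Real.exp τ) := by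
    refine ((bmI_cont hm).comp (continuous_id.add_const (Real.log (2 * s)))).congr fun τ => ?_
    simp [bm_shift hs]
  fun_prop

lemma bmX_le {m s : ℕ} (hm : m ≤ 1) (hs : 1 ≤ s) (τ : ℝ) : |bmX m s τ| ≤
    Real.exp (-(2 * s) * Real.exp τ) * (Real.exp τ ^ m * bmN m (2 * s * Real.exp τ)) := by
  have h := bmK_le hm (τ + Real.log (2 * s))
  rw [bm_shift hs] at h
  unfold bmX
  rw [abs_mul, abs_mul, abs_pow, abs_neg, abs_one, one_pow, one_mul, abs_of_pos (by positivity : 0 < Real.exp τ ^ m)]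
  calc _ ≤ Real.exp τ ^ m * (Real.exp (-(2 * s * Real.exp τ)) * bmN m (2 * s * Real.exp τ)) := by gcongr
    _ = _ := by rw [neg_mul]; ring

lemma bmY_le {m s : ℕ} (hm : m ≤ 1) (hs : 1 ≤ s) (τ : ℝ) : |bmY m s τ| ≤
    Real.exp ((2 * s) * Real.exp τ) * (Real.exp τ ^ m * bmN m (2 * s * Real.exp τ)) := by
  have h := bmI_le hm (τ + Real.log (2 * s))
  rw [bm_shift hs] at h
  unfold bmY
  rw [abs_mul, abs_of_pos (by positivity : 0 < Real.exp τ ^ m)]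
  calc _ ≤ Real.exp τ ^ m * (Real.exp (2 * s * Real.exp τ) * bmN m (2 * s * Real.exp τ)) := by gcongr
    _ = _ := by ring

lemma bmT_integrable {m : ℕ} (hm : m ≤ 1) {k l s : ℕ} (hk : 2 ≤ k) (hl : 1 ≤ l) (hlk : 2 * l + m ≤ k)
    (hs : 1 ≤ s) {Z : ℝ → ℝ} (hZ : Continuous Z) {a : ℝ}
    (hZb : ∀ τ, |Z τ| ≤ Real.exp (a * Real.exp τ) * (Real.exp τ ^ m * bmN m (2 * s * Real.exp τ)))
    {p q : ℕ} (hpq : p + q = 2 * k) (ha : a + p ≤ q) : Integrable (bmT l Z p q) := by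
  have hs0 : (0:ℝ) < 2 * s := by positivity
  obtain ⟨C, hC, H⟩ := bm_bound hm hk hl hlk hs0
  have c1 := bmK_cont (m := 0) (by norm_num)
  have c2 := bmI_cont (m := 0) (by norm_num)
  have hcont : Continuous (bmT l Z p q) := by
    unfold bmT
    fun_prop
  refine Integrable.mono' (bm_exp_abs_integrable.const_mul C) hcont.aestronglyMeasurable
    (Eventually.of_forall fun τ => le_trans ?_ (H τ))
  have b1 := bmK_le (m := 0) (by norm_num) τ
  have b2 := bmI_le (m := 0) (by norm_num) τ
  have b3 := hZb τ
  unfold bmT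
  rw [Real.norm_eq_abs, abs_mul, abs_mul, abs_mul, abs_pow, abs_pow, abs_pow, abs_of_pos (Real.exp_pos τ)]
  have hρ0 : 0 < Real.exp τ := Real.exp_pos _
  generalize Real.exp τ = ρ at *
  have n1 := bmN_nonneg m (2 * s * ρ)
  have n2 := bmN_nonneg 0 ρ
  calc _ ≤ ρ ^ (2 * l) * (Real.exp (a * ρ) * (ρ ^ m * bmN m (2 * s * ρ))) * (Real.exp ρ * bmN 0 ρ) ^ p *
        (Real.exp (-ρ) * bmN 0 ρ) ^ q := by gcongr
    _ = (ρ ^ (2 * l) * (ρ ^ m * bmN m (2 * s * ρ)) * bmN 0 ρ ^ (p + q)) *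
        (Real.exp (a * ρ) * Real.exp ρ ^ p * Real.exp (-ρ) ^ q) := by
        rw [mul_pow, mul_pow, pow_add]; ring
    _ ≤ (ρ ^ (2 * l) * (ρ ^ m * bmN m (2 * s * ρ)) * bmN 0 ρ ^ (p + q)) * 1 := by
        gcongr
        rw [← Real.exp_nat_mul, ← Real.exp_nat_mul, ← Real.exp_add, ← Real.exp_add, Real.exp_le_one_iff]
        nlinarith
    _ = _ := by rw [hpq, mul_one]

lemma bm_expand (n M : ℕ) (hn : n < 2 * M) (A B : ℝ) : ((A:ℂ) + Complex.I * B) ^ n =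
    ((∑ j ∈ Finset.range M, (-1) ^ j * (n.choose (2 * j) : ℝ) * (B ^ (2 * j) * A ^ (n - 2 * j)) : ℝ) : ℂ) +
    Complex.I * ((∑ j ∈ Finset.range M, (-1) ^ j * (n.choose (2 * j + 1) : ℝ) *
      (B ^ (2 * j + 1) * A ^ (n - (2 * j + 1))) : ℝ) : ℂ) := by
  have h1 : ((A:ℂ) + Complex.I * B) ^ n = ∑ i ∈ Finset.range (2 * M), (Complex.I * B) ^ i * (A:ℂ) ^ (n - i) * (n.choose i : ℂ) := by
    rw [add_comm, add_pow]
    refine Finset.sum_subset (fun i hi => ?_) (fun i _ hi => ?_)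
    · simp only [Finset.mem_range] at *; omega
    · simp only [Finset.mem_range, not_lt] at hi
      rw [Nat.choose_eq_zero_of_lt (by omega)]; simp
  rw [h1]
  clear h1 hn
  induction M with
  | zero => simp
  | succ M ih =>
    rw [show 2 * (M + 1) = 2 * M + 1 + 1 by ring, Finset.sum_range_succ, Finset.sum_range_succ, ih,
      Finset.sum_range_succ, Finset.sum_range_succ]
    push_cast
    rw [mul_pow, mul_pow, pow_succ Complex.I, pow_mul Complex.I, Complex.I_sq]
    ring

lemma bm_re (n M : ℕ) (hn : n < 2 * M) (A B : ℝ) : (((A:ℂ) + Complex.I * B) ^ n).re =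
    ∑ j ∈ Finset.range M, (-1) ^ j * (n.choose (2 * j) : ℝ) * (B ^ (2 * j) * A ^ (n - 2 * j)) := by
  rw [bm_expand n M hn]
  simp only [Complex.add_re, Complex.ofReal_re, Complex.I_mul_re, Complex.ofReal_im, neg_zero, add_zero]

lemma bm_im (n M : ℕ) (hn : n ≤ 2 * M) (A B : ℝ) : (((A:ℂ) + Complex.I * B) ^ n).im =
    ∑ j ∈ Finset.range M, (-1) ^ j * (n.choose (2 * j + 1) : ℝ) * (B ^ (2 * j + 1) * A ^ (n - (2 * j + 1))) := by
  rw [bm_expand n (M + 1) (by omega)]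
  simp only [Complex.add_im, Complex.ofReal_re, Complex.I_mul_im, Complex.ofReal_im, zero_add]
  rw [Finset.sum_range_succ, Nat.choose_eq_zero_of_lt (by omega : n < 2 * M + 1)]
  simp

/-- Integral identity obtained from the contour argument. -/
lemma bm_main {m : ℕ} (hm : m ≤ 1) {k l s : ℕ} (hk : 2 ≤ k) (hl : 1 ≤ l) (hlk : 2 * l + m ≤ k)
    (hs : 1 ≤ s) (hsk : s ≤ k) :
    (∫ τ, Real.exp τ ^ (2 * l) * (bmX m s τ * ((bmK 0 (Real.exp τ) + Complex.I * bmI 0 (Real.exp τ) : ℂ) ^ (k - s)).im +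
        bmY m s τ * ((bmK 0 (Real.exp τ) + Complex.I * bmI 0 (Real.exp τ) : ℂ) ^ (k - s)).re) * bmK 0 (Real.exp τ) ^ (k + s) +
      Real.exp τ ^ (2 * l) * bmX m s τ * bmK 0 (Real.exp τ) ^ (k - s) *
        ((bmK 0 (Real.exp τ) + Complex.I * bmI 0 (Real.exp τ) : ℂ) ^ (k + s)).im = 0) ∧
    (∫ τ, Real.exp τ ^ (2 * l) * (bmX m s τ * ((bmK 0 (Real.exp τ) + Complex.I * bmI 0 (Real.exp τ) : ℂ) ^ (k - s)).re -
        bmY m s τ * ((bmK 0 (Real.exp τ) + Complex.I * bmI 0 (Real.exp τ) : ℂ) ^ (k - s)).im) * bmK 0 (Real.exp τ) ^ (k + s) -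
      Real.exp τ ^ (2 * l) * bmX m s τ * bmK 0 (Real.exp τ) ^ (k - s) *
        ((bmK 0 (Real.exp τ) + Complex.I * bmI 0 (Real.exp τ) : ℂ) ^ (k + s)).re = 0) := by
  have hπ := Real.pi_pos
  have hs0 : (0:ℝ) < 2 * s := by positivity
  obtain ⟨C, hC, H⟩ := bm_bound hm hk hl hlk hs0
  have hb : ∀ w ∈ bmS, ‖bmG m k s l w‖ ≤ C * Real.exp (-|w.re| / 4) := fun w _ =>
    (bmG_norm hm hs hsk l w).trans (H w.re)
  have hc := bmG_cont hm k s l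
  have key := bm_cauchy hc (bmG_diff hm k s l) hb
  have i1 := bm_line_integrable hc hb (y := -Real.pi) le_rfl (by linarith)
  have i2 := bm_line_integrable hc hb (y := 0) (by linarith) le_rfl
  have hz : ∫ x : ℝ, (bmG m k s l (x + (-Real.pi : ℝ) * Complex.I) - bmG m k s l (x + (0:ℝ) * Complex.I)) = 0 := by
    rw [integral_sub i1 i2, key, sub_self]
  have i3 := i1.sub i2
  have hform : ∀ τ : ℝ, bmG m k s l (τ + (-Real.pi : ℝ) * Complex.I) - bmG m k s l (τ + (0:ℝ) * Complex.I) =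
      ((Real.exp τ ^ (2 * l) : ℝ) : ℂ) * ((bmX m s τ : ℂ) + Complex.I * bmY m s τ) *
        (bmK 0 (Real.exp τ) + Complex.I * bmI 0 (Real.exp τ) : ℂ) ^ (k - s) * ((bmK 0 (Real.exp τ) ^ (k + s) : ℝ) : ℂ) -
      ((Real.exp τ ^ (2 * l) * bmX m s τ * bmK 0 (Real.exp τ) ^ (k - s) : ℝ) : ℂ) *
        starRingEnd ℂ ((bmK 0 (Real.exp τ) + Complex.I * bmI 0 (Real.exp τ) : ℂ) ^ (k + s)) := by
    intro τ
    rw [bmG_top m k l hs, bmG_bot hm k l hs]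
    simp only [bmX, bmY, map_pow, map_add, map_mul, Complex.conj_ofReal, Complex.conj_I]
    push_cast
    ring
  constructor
  · have := Complex.imCLM.integral_comp_comm i3
    rw [show (∫ x : ℝ, ((fun x : ℝ => bmG m k s l (x + (-Real.pi : ℝ) * Complex.I)) -
      (fun x : ℝ => bmG m k s l (x + (0:ℝ) * Complex.I))) x) = 0 from hz, map_zero] at this
    rw [← this]
    refine integral_congr_ae (Eventually.of_forall fun τ => ?_)
    simp only [Pi.sub_apply, hform, Complex.imCLM_apply, Complex.sub_im, Complex.mul_im, Complex.mul_re,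
      Complex.ofReal_re, Complex.ofReal_im, Complex.conj_im, Complex.conj_re, Complex.add_im, Complex.add_re,
      Complex.I_re, Complex.I_im]
    ring
  · have := Complex.reCLM.integral_comp_comm i3
    rw [show (∫ x : ℝ, ((fun x : ℝ => bmG m k s l (x + (-Real.pi : ℝ) * Complex.I)) -
      (fun x : ℝ => bmG m k s l (x + (0:ℝ) * Complex.I))) x) = 0 from hz, map_zero] at this
    rw [← this]
    refine integral_congr_ae (Eventually.of_forall fun τ => ?_)
    simp only [Pi.sub_apply, hform, Complex.reCLM_apply, Complex.sub_re, Complex.mul_im, Complex.mul_re,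
      Complex.ofReal_re, Complex.ofReal_im, Complex.conj_im, Complex.conj_re, Complex.add_im, Complex.add_re,
      Complex.I_re, Complex.I_im]
    ring


lemma bm_sumint (S : Finset ℕ) (c : ℕ → ℝ) (f : ℕ → ℝ → ℝ) (h : ∀ j ∈ S, c j ≠ 0 → Integrable (f j)) :
    Integrable (fun τ => ∑ j ∈ S, c j * f j τ) ∧ ∫ τ, ∑ j ∈ S, c j * f j τ = ∑ j ∈ S, c j * ∫ τ, f j τ := by
  have hi : ∀ j ∈ S, Integrable (fun τ => c j * f j τ) := by
    intro j hj
    by_cases h0 : c j = 0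
    · simp [h0]
    · exact (h j hj h0).const_mul _
  refine ⟨integrable_finsetSum _ hi, ?_⟩
  rw [integral_finsetSum _ hi]
  exact Finset.sum_congr rfl fun j _ => integral_const_mul _ _

lemma bm_term {k a n p : ℕ} (h : n + a = 2 * k) (hp : ¬ n < p) (e Z A B : ℝ) :
    e * Z * (B ^ p * A ^ (n - p)) * A ^ a = e * Z * B ^ p * A ^ (2 * k - p) := by
  have : 2 * k - p = (n - p) + a := by omega
  rw [this, pow_add]; ring

/-- Real and imaginary parts times a power, as sums of generic integrands. -/
lemma bm_sum_re {k a n M l : ℕ} (h : n + a = 2 * k) (hn : n < 2 * M) (Z : ℝ → ℝ) (τ : ℝ) :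
    Real.exp τ ^ (2 * l) * Z τ * ((bmK 0 (Real.exp τ) + Complex.I * bmI 0 (Real.exp τ) : ℂ) ^ n).re *
      bmK 0 (Real.exp τ) ^ a = ∑ j ∈ Finset.range M, ((-1) ^ j * (n.choose (2 * j) : ℝ)) *
        bmT l Z (2 * j) (2 * k - 2 * j) τ := by
  rw [bm_re n M hn, Finset.mul_sum, Finset.sum_mul]
  refine Finset.sum_congr rfl fun j _ => ?_
  by_cases hj : n < 2 * j
  · rw [Nat.choose_eq_zero_of_lt hj]; simp
  · unfold bmT
    rw [← bm_term h hj]; ring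

lemma bm_sum_im {k a n M l : ℕ} (h : n + a = 2 * k) (hn : n ≤ 2 * M) (Z : ℝ → ℝ) (τ : ℝ) :
    Real.exp τ ^ (2 * l) * Z τ * ((bmK 0 (Real.exp τ) + Complex.I * bmI 0 (Real.exp τ) : ℂ) ^ n).im *
      bmK 0 (Real.exp τ) ^ a = ∑ j ∈ Finset.range M, ((-1) ^ j * (n.choose (2 * j + 1) : ℝ)) *
        bmT l Z (2 * j + 1) (2 * k - (2 * j + 1)) τ := by
  rw [bm_im n M hn, Finset.mul_sum, Finset.sum_mul]
  refine Finset.sum_congr rfl fun j _ => ?_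
  by_cases hj : n < 2 * j + 1
  · rw [Nat.choose_eq_zero_of_lt hj]; simp
  · unfold bmT
    rw [← bm_term h hj]; ring

/-- Moments. -/
noncomputable def bmTX (m s l p q : ℕ) : ℝ := ∫ τ, bmT l (bmX m s) p q τ

/-- Moments. -/
noncomputable def bmTY (m s l p q : ℕ) : ℝ := ∫ τ, bmT l (bmY m s) p q τ

lemma bm_choose_ne {n p : ℕ} {e : ℝ} (h : e * (n.choose p : ℝ) ≠ 0) : p ≤ n := by
  by_contra hp
  rw [Nat.choose_eq_zero_of_lt (by omega)] at h
  simp at h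

lemma bm_identities {m : ℕ} (hm : m ≤ 1) {k l s : ℕ} (hk : 2 ≤ k) (hl : 1 ≤ l) (hlk : 2 * l + m ≤ k)
    (hs : 1 ≤ s) (hsk : s ≤ k) :
    (∀ M1 M2 : ℕ, k - s < 2 * M1 → k + s ≤ 2 * M2 →
      ∑ j ∈ Finset.range M1, ((-1) ^ j * ((k - s).choose (2 * j) : ℝ)) * bmTY m s l (2 * j) (2 * k - 2 * j) +
      ∑ j ∈ Finset.range M2, ((-1) ^ j * (((k - s).choose (2 * j + 1) : ℝ) + ((k + s).choose (2 * j + 1) : ℝ))) *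
        bmTX m s l (2 * j + 1) (2 * k - (2 * j + 1)) = 0) ∧
    (∀ M1 M2 : ℕ, k - s ≤ 2 * M1 → k + s < 2 * M2 →
      ∑ j ∈ Finset.range M1, ((-1) ^ j * ((k - s).choose (2 * j + 1) : ℝ)) * bmTY m s l (2 * j + 1) (2 * k - (2 * j + 1)) -
      ∑ j ∈ Finset.range M2, ((-1) ^ j * (((k - s).choose (2 * j) : ℝ) - ((k + s).choose (2 * j) : ℝ))) *
        bmTX m s l (2 * j) (2 * k - 2 * j) = 0) := by
  obtain ⟨h1, h2⟩ := bm_main hm hk hl hlk hs hsk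
  have e1 : k - s + (k + s) = 2 * k := by omega
  have e2 : k + s + (k - s) = 2 * k := by omega
  have hX : ∀ p : ℕ, p ≤ k + s → Integrable (bmT l (bmX m s) p (2 * k - p)) := fun p hp => by
    refine bmT_integrable hm hk hl hlk hs (bmX_cont hm hs) (bmX_le hm hs) (by omega) ?_
    have : p ≤ (2 * k - p) + 2 * s := by omega
    have : (p : ℝ) ≤ ((2 * k - p : ℕ) : ℝ) + 2 * s := by exact_mod_cast this
    linarith
  have hY : ∀ p : ℕ, p ≤ k - s → Integrable (bmT l (bmY m s) p (2 * k - p)) := fun p hp => by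
    refine bmT_integrable hm hk hl hlk hs (bmY_cont hm hs) (bmY_le hm hs) (by omega) ?_
    have : 2 * s + p ≤ (2 * k - p) := by omega
    exact_mod_cast this
  constructor
  · intro M1 M2 hM1 hM2
    obtain ⟨a1, b1⟩ := bm_sumint (Finset.range M1) (fun j => (-1) ^ j * ((k - s).choose (2 * j) : ℝ))
      (fun j => bmT l (bmY m s) (2 * j) (2 * k - 2 * j)) (fun j _ hj => hY _ (bm_choose_ne hj))
    obtain ⟨a2, b2⟩ := bm_sumint (Finset.range M2) (fun j => (-1) ^ j * ((k - s).choose (2 * j + 1) : ℝ))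
      (fun j => bmT l (bmX m s) (2 * j + 1) (2 * k - (2 * j + 1)))
      (fun j _ hj => hX _ (by have := bm_choose_ne hj; omega))
    obtain ⟨a3, b3⟩ := bm_sumint (Finset.range M2) (fun j => (-1) ^ j * ((k + s).choose (2 * j + 1) : ℝ))
      (fun j => bmT l (bmX m s) (2 * j + 1) (2 * k - (2 * j + 1)))
      (fun j _ hj => hX _ (by have := bm_choose_ne hj; omega))
    have h3 := integral_add (a1.add a2) a3
    have h4 := integral_add a1 a2
    simp only [Pi.add_apply] at h3 h4
    rw [h4, b1, b2, b3] at h3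
    have h5 : ∑ j ∈ Finset.range M2, ((-1) ^ j * (((k - s).choose (2 * j + 1) : ℝ) + ((k + s).choose (2 * j + 1) : ℝ))) *
        bmTX m s l (2 * j + 1) (2 * k - (2 * j + 1)) =
        ∑ j ∈ Finset.range M2, ((-1) ^ j * ((k - s).choose (2 * j + 1) : ℝ)) * bmTX m s l (2 * j + 1) (2 * k - (2 * j + 1)) +
        ∑ j ∈ Finset.range M2, ((-1) ^ j * ((k + s).choose (2 * j + 1) : ℝ)) * bmTX m s l (2 * j + 1) (2 * k - (2 * j + 1)) := by
      rw [← Finset.sum_add_distrib]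
      exact Finset.sum_congr rfl fun j _ => by ring
    rw [h5, ← add_assoc]
    unfold bmTX bmTY
    rw [← h3, ← h1]
    refine integral_congr_ae (Eventually.of_forall fun τ => ?_)
    simp only []
    rw [← bm_sum_re e1 hM1, ← bm_sum_im e1 (by omega), ← bm_sum_im e2 hM2]
    ring
  · intro M1 M2 hM1 hM2
    obtain ⟨a1, b1⟩ := bm_sumint (Finset.range M1) (fun j => (-1) ^ j * ((k - s).choose (2 * j + 1) : ℝ))
      (fun j => bmT l (bmY m s) (2 * j + 1) (2 * k - (2 * j + 1))) (fun j _ hj => hY _ (bm_choose_ne hj))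
    obtain ⟨a2, b2⟩ := bm_sumint (Finset.range M2) (fun j => (-1) ^ j * ((k - s).choose (2 * j) : ℝ))
      (fun j => bmT l (bmX m s) (2 * j) (2 * k - 2 * j))
      (fun j _ hj => hX _ (by have := bm_choose_ne hj; omega))
    obtain ⟨a3, b3⟩ := bm_sumint (Finset.range M2) (fun j => (-1) ^ j * ((k + s).choose (2 * j) : ℝ))
      (fun j => bmT l (bmX m s) (2 * j) (2 * k - 2 * j))
      (fun j _ hj => hX _ (by have := bm_choose_ne hj; omega))
    have h3 := integral_sub (a2.sub a1) a3
    have h4 := integral_sub a2 a1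
    simp only [Pi.sub_apply] at h3 h4
    rw [h4, b1, b2, b3] at h3
    have h5 : ∑ j ∈ Finset.range M2, ((-1) ^ j * (((k - s).choose (2 * j) : ℝ) - ((k + s).choose (2 * j) : ℝ))) *
        bmTX m s l (2 * j) (2 * k - 2 * j) =
        ∑ j ∈ Finset.range M2, ((-1) ^ j * ((k - s).choose (2 * j) : ℝ)) * bmTX m s l (2 * j) (2 * k - 2 * j) -
        ∑ j ∈ Finset.range M2, ((-1) ^ j * ((k + s).choose (2 * j) : ℝ)) * bmTX m s l (2 * j) (2 * k - 2 * j) := by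
      rw [← Finset.sum_sub_distrib]
      exact Finset.sum_congr rfl fun j _ => by ring
    rw [h5, ← neg_eq_zero]
    unfold bmTX bmTY
    rw [← h2]
    trans ∫ τ, (∑ j ∈ Finset.range M2, ((-1) ^ j * ((k - s).choose (2 * j) : ℝ)) * bmT l (bmX m s) (2 * j) (2 * k - 2 * j) τ) -
        (∑ j ∈ Finset.range M1, ((-1) ^ j * ((k - s).choose (2 * j + 1) : ℝ)) *
          bmT l (bmY m s) (2 * j + 1) (2 * k - (2 * j + 1)) τ) -
        ∑ j ∈ Finset.range M2, ((-1) ^ j * ((k + s).choose (2 * j) : ℝ)) * bmT l (bmX m s) (2 * j) (2 * k - 2 * j) τ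
    · rw [h3]; ring
    refine integral_congr_ae (Eventually.of_forall fun τ => ?_)
    simp only []
    rw [← bm_sum_im e1 hM1, ← bm_sum_re e1 (by omega), ← bm_sum_re e2 hM2]
    ring

/-- Purely algebraic assembly of the two sum rules. -/
lemma bm_assemble {k s : ℕ} (hk : 2 ≤ k) (hsk : s ≤ k) (mu : ℕ → ℝ)
    (TX TY : ℕ → ℕ → ℝ) (r : ℝ)
    (h1 : (2 * (k : ℝ) + 1) * mu 1 = r * (TY 0 (2 * k) + 2 * k * TX 1 (2 * k - 1)))
    (h2 : ∀ j, 2 ≤ j → j ≤ k → mu j = r * TY (j - 1) (2 * k + 1 - j))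
    (h3 : ∀ j, k + 1 ≤ j → mu j = r * TX (j - k + 1) (3 * k - j - 1))
    (I1 : ∀ M1 M2 : ℕ, k - s < 2 * M1 → k + s ≤ 2 * M2 →
      ∑ j ∈ Finset.range M1, ((-1) ^ j * ((k - s).choose (2 * j) : ℝ)) * TY (2 * j) (2 * k - 2 * j) +
      ∑ j ∈ Finset.range M2, ((-1) ^ j * (((k - s).choose (2 * j + 1) : ℝ) + ((k + s).choose (2 * j + 1) : ℝ))) *
        TX (2 * j + 1) (2 * k - (2 * j + 1)) = 0)
    (I2 : ∀ M1 M2 : ℕ, k - s ≤ 2 * M1 → k + s < 2 * M2 →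
      ∑ j ∈ Finset.range M1, ((-1) ^ j * ((k - s).choose (2 * j + 1) : ℝ)) * TY (2 * j + 1) (2 * k - (2 * j + 1)) -
      ∑ j ∈ Finset.range M2, ((-1) ^ j * (((k - s).choose (2 * j) : ℝ) - ((k + s).choose (2 * j) : ℝ))) *
        TX (2 * j) (2 * k - 2 * j) = 0) (hs : 1 ≤ s) :
    ((2 * (k : ℝ) + 1) * mu 1 +
          (∑ j ∈ Finset.Icc 1 ((k - s) / 2),
            (-1 : ℝ) ^ j * ((k - s).choose (2 * j) : ℝ) * mu (2 * j + 1)) +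
          (∑ j ∈ Finset.Icc 1 ((k - 1 + s) / 2),
            (-1 : ℝ) ^ j * (((k - s).choose (2 * j + 1) : ℝ) + ((k + s).choose (2 * j + 1) : ℝ)) *
              mu (2 * j + k)) = 0) ∧
      ((∑ j ∈ Finset.Icc (0 : ℤ) (((k : ℤ) - 1 - s) / 2),
            (-1 : ℝ) ^ j * ((k - s).choose (2 * j.toNat + 1) : ℝ) *
              mu (2 * j.toNat + 2)) -
          (∑ j ∈ Finset.Icc 1 ((k + s) / 2),
            (-1 : ℝ) ^ j * (((k - s).choose (2 * j) : ℝ) - ((k + s).choose (2 * j) : ℝ)) *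
              mu (2 * j + k - 1)) = 0) := by
  have hsplit : ∀ (N : ℕ) (f : ℕ → ℝ), ∑ j ∈ Finset.range (N + 1), f j = f 0 + ∑ j ∈ Finset.Icc 1 N, f j := by
    intro N f
    rw [Finset.range_eq_Ico, Finset.sum_eq_sum_Ico_succ_bot (by omega)]
    rfl
  constructor
  · have := I1 ((k - s) / 2 + 1) ((k - 1 + s) / 2 + 1) (by omega) (by omega)
    rw [hsplit, hsplit] at this
    have c1 : ∑ j ∈ Finset.Icc 1 ((k - s) / 2), (-1 : ℝ) ^ j * ((k - s).choose (2 * j) : ℝ) * mu (2 * j + 1) =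
        r * ∑ j ∈ Finset.Icc 1 ((k - s) / 2), ((-1) ^ j * ((k - s).choose (2 * j) : ℝ)) * TY (2 * j) (2 * k - 2 * j) := by
      rw [Finset.mul_sum]
      refine Finset.sum_congr rfl fun j hj => ?_
      rw [Finset.mem_Icc] at hj
      rw [h2 _ (by omega) (by omega), show 2 * j + 1 - 1 = 2 * j by omega,
        show 2 * k + 1 - (2 * j + 1) = 2 * k - 2 * j by omega]
      ring
    have c2 : ∑ j ∈ Finset.Icc 1 ((k - 1 + s) / 2),
            (-1 : ℝ) ^ j * (((k - s).choose (2 * j + 1) : ℝ) + ((k + s).choose (2 * j + 1) : ℝ)) *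
              mu (2 * j + k) = r * ∑ j ∈ Finset.Icc 1 ((k - 1 + s) / 2),
              ((-1) ^ j * (((k - s).choose (2 * j + 1) : ℝ) + ((k + s).choose (2 * j + 1) : ℝ))) *
        TX (2 * j + 1) (2 * k - (2 * j + 1)) := by
      rw [Finset.mul_sum]
      refine Finset.sum_congr rfl fun j hj => ?_
      rw [Finset.mem_Icc] at hj
      rw [h3 _ (by omega), show 2 * j + k - k + 1 = 2 * j + 1 by omega,
        show 3 * k - (2 * j + k) - 1 = 2 * k - (2 * j + 1) by omega]
      ring
    rw [h1, c1, c2]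
    have e : ((k - s : ℕ) : ℝ) + ((k + s : ℕ) : ℝ) = 2 * k := by push_cast [Nat.cast_sub hsk]; ring
    simp only [pow_zero, mul_zero, zero_add, Nat.choose_zero_right, Nat.choose_one_right, e, Nat.sub_zero,
      Nat.cast_one, one_mul] at this
    linear_combination r * this
  · have := I2 ((k - s + 1) / 2) ((k + s) / 2 + 1) (by omega) (by omega)
    rw [hsplit] at this
    have c1 : ∑ j ∈ Finset.Icc (0 : ℤ) (((k : ℤ) - 1 - s) / 2),
            (-1 : ℝ) ^ j * ((k - s).choose (2 * j.toNat + 1) : ℝ) * mu (2 * j.toNat + 2) =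
        r * ∑ j ∈ Finset.range ((k - s + 1) / 2), ((-1) ^ j * ((k - s).choose (2 * j + 1) : ℝ)) *
          TY (2 * j + 1) (2 * k - (2 * j + 1)) := by
      rw [Finset.mul_sum]
      refine Finset.sum_bij' (fun j _ => j.toNat) (fun j _ => (j : ℤ)) ?_ ?_ ?_ ?_ ?_
      · intro j hj
        simp only [Finset.mem_Icc, Finset.mem_range] at *
        omega
      · intro j hj
        simp only [Finset.mem_Icc, Finset.mem_range] at *
        omega
      · intro j hj
        simp only [Finset.mem_Icc] at *
        omega
      · intro j hj
        simp
      · intro j hj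
        simp only [Finset.mem_Icc] at hj
        obtain ⟨n, rfl⟩ := Int.eq_ofNat_of_zero_le hj.1
        simp only [Int.toNat_natCast, zpow_natCast]
        rw [h2 _ (by omega) (by omega), show 2 * n + 2 - 1 = 2 * n + 1 by omega,
          show 2 * k + 1 - (2 * n + 2) = 2 * k - (2 * n + 1) by omega]
        ring
    have c2 : ∑ j ∈ Finset.Icc 1 ((k + s) / 2),
            (-1 : ℝ) ^ j * (((k - s).choose (2 * j) : ℝ) - ((k + s).choose (2 * j) : ℝ)) *
              mu (2 * j + k - 1) = r * ∑ j ∈ Finset.Icc 1 ((k + s) / 2),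
              ((-1) ^ j * (((k - s).choose (2 * j) : ℝ) - ((k + s).choose (2 * j) : ℝ))) *
        TX (2 * j) (2 * k - 2 * j) := by
      rw [Finset.mul_sum]
      refine Finset.sum_congr rfl fun j hj => ?_
      rw [Finset.mem_Icc] at hj
      rw [h3 _ (by omega), show 2 * j + k - 1 - k + 1 = 2 * j by omega,
        show 3 * k - (2 * j + k - 1) - 1 = 2 * k - 2 * j by omega]
      ring
    rw [c1, c2]
    simp only [pow_zero, mul_zero, Nat.choose_zero_right, sub_self, zero_mul, zero_add] at this
    linear_combination r * this

lemma bm_sqrt (s : ℕ) : Real.sqrt ((2 * (s:ℝ)) ^ 2) = 2 * s := Real.sqrt_sq (by positivity)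

lemma bm_TY_eq (m s l p q : ℕ) (hl : 1 ≤ l) : bmTY m s l p q =
    ∫ t in Ioi (0:ℝ), bmI m (2 * s * t) * bmI 0 t ^ p * bmK 0 t ^ q * (t ^ m * t ^ (2 * l - 1)) := by
  rw [bm_cov]
  unfold bmTY
  refine integral_congr_ae (Eventually.of_forall fun τ => ?_)
  simp only [bmT, bmY]
  have : Real.exp τ ^ (2 * l) = Real.exp τ ^ (2 * l - 1) * Real.exp τ := by
    rw [← pow_succ]; congr 1; omega
  rw [this]; ring

lemma bm_TX_eq (m s l p q : ℕ) (hl : 1 ≤ l) : bmTX m s l p q =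
    ∫ t in Ioi (0:ℝ), (-1) ^ m * (bmK m (2 * s * t) * bmI 0 t ^ p * bmK 0 t ^ q * (t ^ m * t ^ (2 * l - 1))) := by
  rw [bm_cov]
  unfold bmTX
  refine integral_congr_ae (Eventually.of_forall fun τ => ?_)
  simp only [bmT, bmX]
  have : Real.exp τ ^ (2 * l) = Real.exp τ ^ (2 * l - 1) * Real.exp τ := by
    rw [← pow_succ]; congr 1; omega
  rw [this]; ring

lemma bm_IvKM (s l a b : ℕ) (hl : 1 ≤ l) (ha : 1 ≤ a) :
    Real.pi ^ a * IvKM a b (2 * l - 1) ((2 * (s:ℝ)) ^ 2) = bmTY 0 s l (a - 1) b := by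
  rw [bm_TY_eq _ _ _ _ _ hl, IvKM, ← integral_const_mul, bm_sqrt]
  refine setIntegral_congr_fun measurableSet_Ioi fun t ht => ?_
  obtain ⟨c, rfl⟩ : ∃ c, a = c + 1 := ⟨a - 1, by omega⟩
  simp only [← besselI0_eq, ← besselK0_eq, mul_pow, Nat.add_sub_cancel]
  ring

lemma bm_IpKM (s l a b : ℕ) (hl : 1 ≤ l) (ha : 1 ≤ a) :
    Real.pi ^ a * IpKM a b (2 * l - 1) ((2 * (s:ℝ)) ^ 2) = bmTY 1 s l (a - 1) b := by
  rw [bm_TY_eq _ _ _ _ _ hl, IpKM, ← integral_const_mul, bm_sqrt]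
  refine setIntegral_congr_fun measurableSet_Ioi fun t ht => ?_
  obtain ⟨c, rfl⟩ : ∃ c, a = c + 1 := ⟨a - 1, by omega⟩
  simp only [← besselI0_eq, ← besselI1_eq, ← besselK0_eq, mul_pow, Nat.add_sub_cancel]
  ring

lemma bm_IKvM (s l a b : ℕ) (hl : 1 ≤ l) :
    Real.pi ^ a * IKvM a b (2 * l - 1) ((2 * (s:ℝ)) ^ 2) = bmTX 0 s l a (b - 1) := by
  rw [bm_TX_eq _ _ _ _ _ hl, IKvM, ← integral_const_mul, bm_sqrt]
  refine setIntegral_congr_fun measurableSet_Ioi fun t ht => ?_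
  simp only [← besselI0_eq, ← besselK0_eq, mul_pow]
  ring

lemma bm_IKpM (s l a b : ℕ) (hl : 1 ≤ l) (hs : 1 ≤ s) :
    Real.pi ^ a * IKpM a b (2 * l - 1) ((2 * (s:ℝ)) ^ 2) = bmTX 1 s l a (b - 1) := by
  rw [bm_TX_eq _ _ _ _ _ hl, IKpM, ← integral_neg, ← integral_const_mul, bm_sqrt]
  refine setIntegral_congr_fun measurableSet_Ioi fun t ht => ?_
  have ht0 : 0 < t := ht
  have hs0 : (0:ℝ) < 2 * s * t := by positivity
  simp only [← besselI0_eq, ← besselK0_eq, ← besselK1_eq hs0, mul_pow]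
  ring

lemma bm_zpow (a : ℕ) (z e : ℤ) (x y : ℝ) (h : Real.pi ^ a * x = y) (he : z = e + a) :
    Real.pi ^ z * x = Real.pi ^ e * y := by
  rw [← h, he, zpow_add₀ Real.pi_ne_zero, zpow_natCast]; ring

lemma bm_final (k s : ℕ) (hk : 2 ≤ k) (hs1 : 1 ≤ s) (hs2 : s ≤ k) (l : ℕ) (hl : 1 ≤ l)
    (m : ℕ) (hm : m ≤ 1) (hlk : 2 * l + m ≤ k) (mu : ℕ → ℝ) (V W : ℕ → ℕ → ℝ)
    (hV : ∀ a b, 1 ≤ a → Real.pi ^ a * V a b = bmTY m s l (a - 1) b)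
    (hW : ∀ a b, Real.pi ^ a * W a b = bmTX m s l a (b - 1))
    (hmu : ∀ j, mu j = if j = 1 then
      Real.pi ^ (-(k : ℤ)) * ((V 1 (2 * k) + (2 * k : ℝ) * W 1 (2 * k)) / (2 * k + 1))
      else if j ≤ k then Real.pi ^ ((j : ℤ) - k - 1) * V j (2 * k + 1 - j)
      else Real.pi ^ ((j : ℤ) - 2 * k) * W (j - k + 1) (3 * k - j)) :
    ((2 * (k : ℝ) + 1) * mu 1 +
          (∑ j ∈ Finset.Icc 1 ((k - s) / 2),
            (-1 : ℝ) ^ j * ((k - s).choose (2 * j) : ℝ) * mu (2 * j + 1)) +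
          (∑ j ∈ Finset.Icc 1 ((k - 1 + s) / 2),
            (-1 : ℝ) ^ j * (((k - s).choose (2 * j + 1) : ℝ) + ((k + s).choose (2 * j + 1) : ℝ)) *
              mu (2 * j + k)) = 0) ∧
      ((∑ j ∈ Finset.Icc (0 : ℤ) (((k : ℤ) - 1 - s) / 2),
            (-1 : ℝ) ^ j * ((k - s).choose (2 * j.toNat + 1) : ℝ) *
              mu (2 * j.toNat + 2)) -
          (∑ j ∈ Finset.Icc 1 ((k + s) / 2),
            (-1 : ℝ) ^ j * (((k - s).choose (2 * j) : ℝ) - ((k + s).choose (2 * j) : ℝ)) *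
              mu (2 * j + k - 1)) = 0) := by
  obtain ⟨I1, I2⟩ := bm_identities hm hk hl hlk hs1 hs2
  refine bm_assemble hk hs2 mu (bmTX m s l) (bmTY m s l) (Real.pi ^ (-(k:ℤ) - 1)) ?_ ?_ ?_ I1 I2 hs1
  · rw [hmu, if_pos rfl]
    have x1 := bm_zpow 1 (-(k:ℤ)) (-(k:ℤ) - 1) _ _ (hV 1 (2 * k) le_rfl) (by push_cast; ring)
    have x2 := bm_zpow 1 (-(k:ℤ)) (-(k:ℤ) - 1) _ _ (hW 1 (2 * k)) (by push_cast; ring)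
    have hk0 : (2 * (k:ℝ) + 1) ≠ 0 := by positivity
    have : (2 * (k:ℝ) + 1) * (Real.pi ^ (-(k : ℤ)) * ((V 1 (2 * k) + (2 * k : ℝ) * W 1 (2 * k)) / (2 * k + 1))) =
      Real.pi ^ (-(k : ℤ)) * V 1 (2 * k) + 2 * k * (Real.pi ^ (-(k : ℤ)) * W 1 (2 * k)) := by
      field_simp
    rw [this, x1, x2]
    ring
  · intro j hj1 hj2
    rw [hmu, if_neg (by omega), if_pos hj2]
    exact bm_zpow j _ _ _ _ (hV j _ (by omega)) (by ring)
  · intro j hj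
    rw [hmu, if_neg (by omega), if_neg (by omega)]
    exact bm_zpow (j - k + 1) _ _ _ _ (hW _ _) (by omega)

end BesselAux

/-- sum rules for Bessel moments at the even thresholds `u = (2s)²`. -/
theorem sum_rules_even_threshold (k s : ℕ) (hk : 2 ≤ k) (hs1 : 1 ≤ s) (hs2 : s ≤ k) :
    (∀ l : ℕ, 1 ≤ l → l ≤ k / 2 →
      ((2 * (k : ℝ) + 1) * muS k l 1 ((2 * (s : ℝ)) ^ 2) +
          (∑ j ∈ Finset.Icc 1 ((k - s) / 2),
            (-1 : ℝ) ^ j * ((k - s).choose (2 * j) : ℝ) * muS k l (2 * j + 1) ((2 * (s : ℝ)) ^ 2)) +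
          (∑ j ∈ Finset.Icc 1 ((k - 1 + s) / 2),
            (-1 : ℝ) ^ j * (((k - s).choose (2 * j + 1) : ℝ) + ((k + s).choose (2 * j + 1) : ℝ)) *
              muS k l (2 * j + k) ((2 * (s : ℝ)) ^ 2)) = 0) ∧
      ((∑ j ∈ Finset.Icc (0 : ℤ) (((k : ℤ) - 1 - s) / 2),
            (-1 : ℝ) ^ j * ((k - s).choose (2 * j.toNat + 1) : ℝ) *
              muS k l (2 * j.toNat + 2) ((2 * (s : ℝ)) ^ 2)) -
          (∑ j ∈ Finset.Icc 1 ((k + s) / 2),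
            (-1 : ℝ) ^ j * (((k - s).choose (2 * j) : ℝ) - ((k + s).choose (2 * j) : ℝ)) *
              muS k l (2 * j + k - 1) ((2 * (s : ℝ)) ^ 2)) = 0)) ∧
    (∀ l : ℕ, 1 ≤ l → l ≤ (k - 1) / 2 →
      ((2 * (k : ℝ) + 1) * muSp k l 1 ((2 * (s : ℝ)) ^ 2) +
          (∑ j ∈ Finset.Icc 1 ((k - s) / 2),
            (-1 : ℝ) ^ j * ((k - s).choose (2 * j) : ℝ) * muSp k l (2 * j + 1) ((2 * (s : ℝ)) ^ 2)) +
          (∑ j ∈ Finset.Icc 1 ((k - 1 + s) / 2),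
            (-1 : ℝ) ^ j * (((k - s).choose (2 * j + 1) : ℝ) + ((k + s).choose (2 * j + 1) : ℝ)) *
              muSp k l (2 * j + k) ((2 * (s : ℝ)) ^ 2)) = 0) ∧
      ((∑ j ∈ Finset.Icc (0 : ℤ) (((k : ℤ) - 1 - s) / 2),
            (-1 : ℝ) ^ j * ((k - s).choose (2 * j.toNat + 1) : ℝ) *
              muSp k l (2 * j.toNat + 2) ((2 * (s : ℝ)) ^ 2)) -
          (∑ j ∈ Finset.Icc 1 ((k + s) / 2),
            (-1 : ℝ) ^ j * (((k - s).choose (2 * j) : ℝ) - ((k + s).choose (2 * j) : ℝ)) *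
              muSp k l (2 * j + k - 1) ((2 * (s : ℝ)) ^ 2)) = 0)) := by
  constructor
  · intro l hl hlk
    exact bm_final k s hk hs1 hs2 l hl 0 (by norm_num) (by omega) (fun j => muS k l j ((2 * (s : ℝ)) ^ 2))
      (fun a b => IvKM a b (2 * l - 1) ((2 * (s : ℝ)) ^ 2)) (fun a b => IKvM a b (2 * l - 1) ((2 * (s : ℝ)) ^ 2))
      (fun a b ha => bm_IvKM s l a b hl ha) (fun a b => bm_IKvM s l a b hl) (fun j => rfl)
  · intro l hl hlk
    exact bm_final k s hk hs1 hs2 l hl 1 (by norm_num) (by omega) (fun j => muSp k l j ((2 * (s : ℝ)) ^ 2))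
      (fun a b => IpKM a b (2 * l - 1) ((2 * (s : ℝ)) ^ 2)) (fun a b => IKpM a b (2 * l - 1) ((2 * (s : ℝ)) ^ 2))
      (fun a b ha => bm_IpKM s l a b hl ha) (fun a b => bm_IKpM s l a b hl hs1) (fun j => rfl)
end
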